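/- Let 1 be the trivial weight of K. If the image of f_0 + f_1 in (ind_K^G 1)/(T+1) generates (ind_K^G 1)/(T+1) as a representation of G, then f_0 + f_1 generates ind_K^G 1 as a representation of G. -/

import Mathlib

open scoped Classical

noncomputable section

namespace U21

/-- The arithmetic setting: `E` is the unramified quadratic extension of a non-archimedean
local field `F` of odd residue characteristic `p`, with residue field of `F` of cardinality
`q = p ^ fdeg`.  The field `E` is encoded through its valuation subring `O = o_E`, a
uniformizer `ϖ`, the maximal ideal `mI` (so that `p_E^k` is `ϖ ^ k * O`), and the nontrivial
`F`-automorphism `conj` of `E` (which induces the `q`-power Frobenius on the residue field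
of `E`, of cardinality `q ^ 2`). -/
structure Setting where
  p : ℕ
  q : ℕ
  fdeg : ℕ
  hp : p.Prime
  hodd : p ≠ 2
  hfdeg : 0 < fdeg
  hq : q = p ^ fdeg
  E : Type
  [fieldE : Field E]
  conj : E →+* E
  conj_invol : ∀ x, conj (conj x) = x
  conj_ne : conj ≠ RingHom.id E
  O : Subring E
  val_ring : ∀ x : E, x ≠ 0 → x ∈ O ∨ x⁻¹ ∈ O
  conj_O : ∀ x, x ∈ O → conj x ∈ O
  ϖ : E
  unif_mem : ϖ ∈ O
  unif_ne : ϖ ≠ 0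
  unif_conj : conj ϖ = ϖ
  unif_not_unit : ¬ IsUnit (⟨ϖ, unif_mem⟩ : O)
  disc : ∀ x : E, x ≠ 0 → ∃ (n : ℤ) (u : Oˣ), x = (u : O) * ϖ ^ n
  mI : Ideal O
  hmI : ∀ x : O, x ∈ mI ↔ ∃ y ∈ O, (x : E) = ϖ * y
  [fin_res : Fintype (O ⧸ mI)]
  card_res : Fintype.card (O ⧸ mI) = q ^ 2
  res_frob : ∀ x : O, Ideal.Quotient.mk mI ⟨conj x, conj_O x x.2⟩ = (Ideal.Quotient.mk mI x) ^ q
  complete : ∀ a : ℕ → E,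
    (∀ k : ℕ, ∃ N, ∀ m ≥ N, ∀ n ≥ N, ∃ w ∈ O, a m - a n = ϖ ^ k * w) →
    ∃ L : E, ∀ k : ℕ, ∃ N, ∀ n ≥ N, ∃ w ∈ O, a n - L = ϖ ^ k * w

attribute [instance] Setting.fieldE Setting.fin_res

namespace Setting

variable (S : Setting)

/-- 3×3 matrices over `E`. -/
abbrev M3 := Matrix (Fin 3) (Fin 3) S.E

/-- The antidiagonal matrix `β` of the Hermitian form. -/
def betaM : S.M3 := !![0,0,1;0,1,0;1,0,0]

/-- The fractional ideal `p_E ^ k ⊆ E` (for `k : ℤ`). -/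
def pE (k : ℤ) : Set S.E := {z | ∃ w ∈ S.O, z = S.ϖ ^ k * w}

/-- The unramified unitary group `G = U(2,1)(E/F)`, as a subgroup of `GL₃(E)`:
`g ∈ G` iff `g.transpose * β * conj g = β`. -/
def Gsub : Subgroup (Matrix.GeneralLinearGroup (Fin 3) S.E) where
  carrier := {g | ((g : S.M3)).transpose * S.betaM * ((g : S.M3).map S.conj) = S.betaM}
  one_mem' := by
    simp [Matrix.map_one (⇑S.conj) (map_zero S.conj) (map_one S.conj)]
  mul_mem' := by
    intro a b ha hb
    simp only [Set.mem_setOf_eq, Units.val_mul, Matrix.transpose_mul, Matrix.map_mul] at ha hb ⊢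
    calc ((b : S.M3)).transpose * ((a : S.M3)).transpose * S.betaM * ((a : S.M3).map S.conj * (b : S.M3).map S.conj)
        = ((b : S.M3)).transpose * (((a : S.M3)).transpose * S.betaM * (a : S.M3).map S.conj) * ((b : S.M3).map S.conj) := by
          simp only [mul_assoc]
      _ = S.betaM := by rw [ha]; exact hb
  inv_mem' := by
    intro a ha
    simp only [Set.mem_setOf_eq] at ha ⊢
    have hA : IsUnit ((a : S.M3)) := a.isUnit
    have hdet : IsUnit ((a : S.M3)).det := (Matrix.isUnit_iff_isUnit_det _).mp hA
    have hAc : IsUnit (((a : S.M3)).map ⇑S.conj) := by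
      rw [← RingHom.mapMatrix_apply]; exact hA.map _
    have hdetc : IsUnit ((((a : S.M3)).map ⇑S.conj).det) := (Matrix.isUnit_iff_isUnit_det _).mp hAc
    have hdetT : IsUnit ((((a : S.M3)).transpose).det) := by rw [Matrix.det_transpose]; exact hdet
    have hmapinv : ((a : S.M3)⁻¹).map ⇑S.conj = (((a : S.M3)).map ⇑S.conj)⁻¹ := by
      symm
      apply Matrix.inv_eq_left_inv
      rw [← Matrix.map_mul, Matrix.nonsing_inv_mul _ hdet,
        Matrix.map_one (⇑S.conj) (map_zero S.conj) (map_one S.conj)]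
    rw [Matrix.coe_units_inv, Matrix.transpose_nonsing_inv, hmapinv]
    conv_lhs => rw [← ha]
    calc (((a:S.M3)).transpose)⁻¹ * (((a:S.M3)).transpose * S.betaM * ((a:S.M3)).map ⇑S.conj) * (((a:S.M3)).map ⇑S.conj)⁻¹
        = (((a:S.M3)).transpose)⁻¹ * ((a:S.M3)).transpose * S.betaM *
            (((a:S.M3)).map ⇑S.conj * (((a:S.M3)).map ⇑S.conj)⁻¹) := by simp only [mul_assoc]
      _ = S.betaM := by
          rw [Matrix.nonsing_inv_mul _ hdetT, Matrix.mul_nonsing_inv _ hdetc, one_mul, mul_one]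

/-- The group `G = U(2,1)(E/F)`. -/
abbrev GG := ↥S.Gsub

/-- The matrix of an element of `G`. -/
def mat (g : S.GG) : S.M3 := ((g : Matrix.GeneralLinearGroup (Fin 3) S.E) : S.M3)

/-- The upper unipotent matrix `n(x,y)`. -/
def nM (x y : S.E) : S.M3 := !![1, x, y; 0, 1, -S.conj x; 0, 0, 1]

/-- The lower unipotent matrix `n'(x,y)`. -/
def n'M (x y : S.E) : S.M3 := !![1, 0, 0; x, 1, 0; y, -S.conj x, 1]

/-- The diagonal matrix `h(x) = diag(x, -x̄x⁻¹, x̄⁻¹)`. -/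
def hM (x : S.E) : S.M3 := !![x, 0, 0; 0, -S.conj x * x⁻¹, 0; 0, 0, (S.conj x)⁻¹]

/-- The subgroup `N` of `G` (unipotent radical of the upper triangular Borel), as a set. -/
def Nset : Set S.GG := {g | ∃ x y : S.E, x * S.conj x + y + S.conj y = 0 ∧ S.mat g = S.nM x y}

/-- The subgroup `N_k = {n(x,y) : y ∈ p_E^k}`, as a set. -/
def Nk (k : ℤ) : Set S.GG :=
  {g | ∃ x y : S.E, x * S.conj x + y + S.conj y = 0 ∧ y ∈ S.pE k ∧ S.mat g = S.nM x y}

/-- The subgroup `N'` of `G`, as a set. -/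
def N'set : Set S.GG := {g | ∃ x y : S.E, x * S.conj x + y + S.conj y = 0 ∧ S.mat g = S.n'M x y}

/-- The subgroup `N'_k = {n'(x,y) : y ∈ p_E^k}`, as a set. -/
def N'k (k : ℤ) : Set S.GG :=
  {g | ∃ x y : S.E, x * S.conj x + y + S.conj y = 0 ∧ y ∈ S.pE k ∧ S.mat g = S.n'M x y}

/-- The diagonal subgroup `H` of `G`, as a set. -/
def Hset : Set S.GG := {g | ∃ a b c : S.E, S.mat g = !![a,0,0;0,b,0;0,0,c]}

/-- The hyperspecial maximal compact subgroup `K₀ = G ∩ GL₃(o_E)`, as a set. -/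
def K0set : Set S.GG := {g | ∀ i j, S.mat g i j ∈ S.O}

/-- The special (non-hyperspecial) maximal compact subgroup `K₁`, as a set. -/
def K1set : Set S.GG :=
  {g | S.mat g 0 0 ∈ S.O ∧ S.mat g 0 1 ∈ S.O ∧ S.mat g 0 2 ∈ S.pE (-1) ∧
       S.mat g 1 0 ∈ S.pE 1 ∧ S.mat g 1 1 ∈ S.O ∧ S.mat g 1 2 ∈ S.O ∧
       S.mat g 2 0 ∈ S.pE 1 ∧ S.mat g 2 1 ∈ S.pE 1 ∧ S.mat g 2 2 ∈ S.O}

/-- The Iwahori subgroup `I_{K₀}` (preimage of the Borel of `Γ_{K₀}`), as a set. -/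
def IK0 : Set S.GG :=
  {g | g ∈ S.K0set ∧ S.mat g 1 0 ∈ S.pE 1 ∧ S.mat g 2 0 ∈ S.pE 1 ∧ S.mat g 2 1 ∈ S.pE 1}

/-- The pro-p Iwahori subgroup `I_{1,K₀}`, as a set. -/
def I1K0 : Set S.GG :=
  {g | g ∈ S.IK0 ∧ S.mat g 0 0 - 1 ∈ S.pE 1 ∧ S.mat g 1 1 - 1 ∈ S.pE 1 ∧ S.mat g 2 2 - 1 ∈ S.pE 1}

/-- The opposite pro-p Iwahori subgroup `I'_{1,K₀}`, as a set. -/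
def I1'K0 : Set S.GG :=
  {g | g ∈ S.K0set ∧ S.mat g 0 1 ∈ S.pE 1 ∧ S.mat g 0 2 ∈ S.pE 1 ∧ S.mat g 1 2 ∈ S.pE 1 ∧
       S.mat g 0 0 - 1 ∈ S.pE 1 ∧ S.mat g 1 1 - 1 ∈ S.pE 1 ∧ S.mat g 2 2 - 1 ∈ S.pE 1}

/-- The maximal normal pro-p subgroup `K₀¹` of `K₀` (principal congruence subgroup), as a set. -/
def Kone0 : Set S.GG := {g | ∀ i j, S.mat g i j - (1 : S.M3) i j ∈ S.pE 1}

/-- The Iwahori subgroup `I_{K₁}`, as a set. -/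
def IK1 : Set S.GG := {g | g ∈ S.K1set ∧ S.mat g 2 0 ∈ S.pE 2}

/-- The pro-p Iwahori subgroup `I_{1,K₁}`, as a set. -/
def I1K1 : Set S.GG :=
  {g | g ∈ S.IK1 ∧ S.mat g 0 0 - 1 ∈ S.pE 1 ∧ S.mat g 1 1 - 1 ∈ S.pE 1 ∧ S.mat g 2 2 - 1 ∈ S.pE 1}

/-- The opposite pro-p Iwahori subgroup `I'_{1,K₁}`, as a set. -/
def I1'K1 : Set S.GG :=
  {g | g ∈ S.K1set ∧ S.mat g 0 2 ∈ S.O ∧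
       S.mat g 0 0 - 1 ∈ S.pE 1 ∧ S.mat g 1 1 - 1 ∈ S.pE 1 ∧ S.mat g 2 2 - 1 ∈ S.pE 1}

/-- The maximal normal pro-p subgroup `K₁¹` of `K₁`, as a set. -/
def Kone1 : Set S.GG :=
  {g | g ∈ S.K1set ∧ S.mat g 0 2 ∈ S.O ∧ S.mat g 2 0 ∈ S.pE 2 ∧
       S.mat g 0 0 - 1 ∈ S.pE 1 ∧ S.mat g 1 1 - 1 ∈ S.pE 1 ∧ S.mat g 2 2 - 1 ∈ S.pE 1}

/-- The congruence subgroup of level `n` (used to express smoothness), as a set. -/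
def cong (n : ℕ) : Set S.GG := {g | ∀ i j, S.mat g i j - (1 : S.M3) i j ∈ S.pE n}

def alphaM : S.M3 := !![S.ϖ⁻¹, 0, 0; 0, 1, 0; 0, 0, S.ϖ]

def alphaMinv : S.M3 := !![S.ϖ, 0, 0; 0, 1, 0; 0, 0, S.ϖ⁻¹]

lemma alpha_mul_inv : S.alphaM * S.alphaMinv = 1 := by
  ext i j
  fin_cases i <;> fin_cases j <;>
    simp [alphaM, alphaMinv, Matrix.mul_apply, Fin.sum_univ_three, Matrix.one_apply,
      Matrix.vecHead, Matrix.vecTail, inv_mul_cancel₀ S.unif_ne, mul_inv_cancel₀ S.unif_ne]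

lemma alpha_inv_mul : S.alphaMinv * S.alphaM = 1 := by
  ext i j
  fin_cases i <;> fin_cases j <;>
    simp [alphaM, alphaMinv, Matrix.mul_apply, Fin.sum_univ_three, Matrix.one_apply,
      Matrix.vecHead, Matrix.vecTail, inv_mul_cancel₀ S.unif_ne, mul_inv_cancel₀ S.unif_ne]

def alphaU : Matrix.GeneralLinearGroup (Fin 3) S.E :=
  ⟨S.alphaM, S.alphaMinv, S.alpha_mul_inv, S.alpha_inv_mul⟩

lemma alphaU_mem : S.alphaU ∈ S.Gsub := by
  show ((S.alphaU : S.M3)).transpose * S.betaM * ((S.alphaU : S.M3).map S.conj) = S.betaM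
  have : (S.alphaU : S.M3) = S.alphaM := rfl
  rw [this]
  ext i j
  fin_cases i <;> fin_cases j <;>
    simp [alphaM, betaM, Matrix.mul_apply, Fin.sum_univ_three, Matrix.map_apply,
      Matrix.transpose_apply, Matrix.vecHead, Matrix.vecTail, map_inv₀, S.unif_conj,
      inv_mul_cancel₀ S.unif_ne, mul_inv_cancel₀ S.unif_ne]

/-- The element `α = diag(ϖ⁻¹, 1, ϖ)` of `G`. -/
def alphaE : S.GG := ⟨S.alphaU, S.alphaU_mem⟩

lemma beta_mul_beta : S.betaM * S.betaM = 1 := by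
  ext i j
  fin_cases i <;> fin_cases j <;>
    simp [betaM, Matrix.mul_apply, Fin.sum_univ_three, Matrix.one_apply,
      Matrix.vecHead, Matrix.vecTail]

def betaU : Matrix.GeneralLinearGroup (Fin 3) S.E :=
  ⟨S.betaM, S.betaM, S.beta_mul_beta, S.beta_mul_beta⟩

lemma betaU_mem : S.betaU ∈ S.Gsub := by
  show ((S.betaU : S.M3)).transpose * S.betaM * ((S.betaU : S.M3).map S.conj) = S.betaM
  have : (S.betaU : S.M3) = S.betaM := rfl
  rw [this]
  ext i j
  fin_cases i <;> fin_cases j <;>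
    simp [betaM, Matrix.mul_apply, Fin.sum_univ_three, Matrix.map_apply, Matrix.transpose_apply,
      Matrix.vecHead, Matrix.vecTail]

/-- The element `β` of `G`. -/
def betaE : S.GG := ⟨S.betaU, S.betaU_mem⟩

/-- The element `β' = β * α⁻¹` of `G`. -/
def betaPr : S.GG := S.betaE * S.alphaE⁻¹

/-- A finite set `U` is a set of representatives for the cosets `A/B`. -/
def IsReps (A B : Set S.GG) (U : Finset S.GG) : Prop :=
  (↑U : Set S.GG) ⊆ A ∧ ∀ a ∈ A, ∃! u, u ∈ U ∧ a⁻¹ * u ∈ B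

/-- The residue field `k_E` of `E`. -/
abbrev kE := S.O ⧸ S.mI

/-- The residue map `o_E → k_E`. -/
def resmap : S.O →+* S.kE := Ideal.Quotient.mk S.mI

/-- The group `L_{q³} = {(x,t) ∈ k_E² : x x̄ + t + t̄ = 0}` (where `x̄ = x^q`). -/
def Lbig : Set (S.kE × S.kE) := {z | z.1 * z.1 ^ S.q + z.2 + z.2 ^ S.q = 0}

/-- The group `L_q = {(0,t) ∈ k_E² : t + t̄ = 0}`. -/
def Lsmall : Set (S.kE × S.kE) := {z | z.1 = 0 ∧ z.2 + z.2 ^ S.q = 0}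

/-- `L_{q^t}` for `t ∈ {1,3}`. -/
def Lof (t : ℕ) : Set (S.kE × S.kE) := if t = 3 then S.Lbig else S.Lsmall

end Setting

/-- A choice of one of the two maximal compact open subgroups `K ∈ {K₀, K₁}` of `G`,
together with its maximal normal pro-p subgroup `K¹`, the (pro-p) Iwahori subgroups
`I_K ⊇ I_{1,K}`, the opposite pro-p Iwahori `I'_{1,K}`, the element
`β_K ∈ K ∩ {β, β'}`, and the integers `n_K, m_K, t_K`. -/
structure Chamber (S : Setting) where
  K : Subgroup S.GG
  KoneS : Set S.GG
  IK : Set S.GG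
  I1 : Set S.GG
  I1' : Set S.GG
  βK : S.GG
  nK : ℤ
  mK : ℤ
  tK : ℕ
  cases :
    ((K : Set S.GG) = S.K0set ∧ KoneS = S.Kone0 ∧ IK = S.IK0 ∧ I1 = S.I1K0 ∧ I1' = S.I1'K0 ∧
      βK = S.betaE ∧ nK = 0 ∧ mK = 1 ∧ tK = 3) ∨
    ((K : Set S.GG) = S.K1set ∧ KoneS = S.Kone1 ∧ IK = S.IK1 ∧ I1 = S.I1K1 ∧ I1' = S.I1'K1 ∧
      βK = S.betaPr ∧ nK = -1 ∧ mK = 2 ∧ tK = 1)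

namespace Chamber

variable {S : Setting} (C : Chamber S)

/-- `H₀ = H ∩ I_K`. -/
def H0 : Set S.GG := S.Hset ∩ C.IK

/-- `H₁ = H ∩ I_{1,K}`. -/
def H1 : Set S.GG := S.Hset ∩ C.I1

end Chamber

section RepTheory

variable {S : Setting} (C : Chamber S)
variable (𝔽 : Type) [Field 𝔽]

section Generic

variable {G₀ : Type} [Monoid G₀] {V : Type} [AddCommGroup V] [Module 𝔽 V]

/-- A submodule is invariant under a representation. -/
def Invt (ρ : Representation 𝔽 G₀ V) (Ssub : Submodule 𝔽 V) : Prop :=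
  ∀ g v, v ∈ Ssub → ρ g v ∈ Ssub

/-- The subrepresentation generated by a vector (the span of its orbit). -/
def orbitSpan (ρ : Representation 𝔽 G₀ V) (v : V) : Submodule 𝔽 V :=
  Submodule.span 𝔽 {w | ∃ g, w = ρ g v}

/-- The subrepresentation generated by a vector under a subset `A` of the group. -/
def orbitSpanOn (ρ : Representation 𝔽 G₀ V) (A : Set G₀) (v : V) : Submodule 𝔽 V :=
  Submodule.span 𝔽 {w | ∃ g ∈ A, w = ρ g v}

/-- The quotient of a representation by an invariant submodule `N` is irreducible:
equivalently (by the lattice correspondence), `N ≠ ⊤` and any invariant submodule lying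
between `N` and `⊤` equals `N` or `⊤`. -/
def QuotientIrreducible (ρ : Representation 𝔽 G₀ V) (N : Submodule 𝔽 V) : Prop :=
  N ≠ ⊤ ∧ ∀ Ssub : Submodule 𝔽 V, Invt 𝔽 ρ Ssub → N ≤ Ssub → Ssub = N ∨ Ssub = ⊤

/-- The submodule of vectors invariant under all elements of the subset `A`. -/
def invariantsOn (ρ : Representation 𝔽 G₀ V) (A : Set G₀) : Submodule 𝔽 V where
  carrier := {v | ∀ g ∈ A, ρ g v = v}
  add_mem' := by
    intro a b ha hb g hg
    rw [map_add, ha g hg, hb g hg]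
  zero_mem' := by
    intro g hg
    rw [map_zero]
  smul_mem' := by
    intro c a ha g hg
    rw [map_smul, ha g hg]

/-- The space `Hom_G(ρ₁, ρ₂)` of equivariant linear maps, as a submodule of the linear maps. -/
def EquivHomSub {V₂ : Type} [AddCommGroup V₂] [Module 𝔽 V₂]
    (ρ₁ : Representation 𝔽 G₀ V) (ρ₂ : Representation 𝔽 G₀ V₂) :
    Submodule 𝔽 (V →ₗ[𝔽] V₂) where
  carrier := {φ | ∀ g x, φ (ρ₁ g x) = ρ₂ g (φ x)}
  add_mem' := by
    intro a b ha hb g x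
    simp only [LinearMap.add_apply, ha g x, hb g x, map_add]
  zero_mem' := by
    intro g x
    simp only [LinearMap.zero_apply, map_zero]
  smul_mem' := by
    intro c a ha g x
    simp only [LinearMap.smul_apply, ha g x, map_smul]

end Generic

section Weight

variable (W : Type) [AddCommGroup W] [Module 𝔽 W]
variable (σ : Representation 𝔽 ↥C.K W)

/-- Extension of `σ` to all of `G` (by `1` outside `K`); used to avoid coercion issues. -/
def sigma' : S.GG → Module.End 𝔽 W := fun g => if h : g ∈ C.K then σ ⟨g, h⟩ else 1

/-- `σ` is a weight of `K`: an irreducible smooth representation of `K` over `𝔽`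
factoring through `Γ_K = K / K¹` (automatically finite dimensional). -/
def IsWeight : Prop :=
  Nontrivial W ∧ FiniteDimensional 𝔽 W ∧
  (∀ Ssub : Submodule 𝔽 W, (∀ (k : ↥C.K) (w : W), w ∈ Ssub → σ k w ∈ Ssub) → Ssub = ⊥ ∨ Ssub = ⊤) ∧
  (∀ (g : S.GG) (hg : g ∈ C.K), g ∈ C.KoneS → σ ⟨g, hg⟩ = LinearMap.id)

/-- `σ` is one dimensional of the form `χ ∘ det`. -/
def IsDetWeight : Prop :=
  Module.finrank 𝔽 W = 1 ∧
  ∃ c : S.E → 𝔽, ∀ (g : S.GG) (hg : g ∈ C.K) (w : W), σ ⟨g, hg⟩ w = c ((S.mat g).det) • w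

/-- `j_σ : σ → σ` is the composition of the coinvariant projection `σ → σ_{I'_{1,K}}`
with the inverse of the natural isomorphism `σ^{I_{1,K}} ≅ σ_{I'_{1,K}}`:
it restricts to the identity on `σ^{I_{1,K}}` and kills the augmentation part of
`σ` with respect to `I'_{1,K}`. -/
def IsJ (jσ : W →ₗ[𝔽] W) : Prop :=
  (∀ w : W, (∀ g ∈ C.I1, sigma' C 𝔽 W σ g w = w) → jσ w = w) ∧
  (∀ (w : W) (g : S.GG), g ∈ C.I1' → jσ (sigma' C 𝔽 W σ g w - w) = 0)

/-- The defining conditions of the compact induction `ind_K^G σ`: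
`K`-equivariance on the left and compact support (finitely many cosets `K g`). -/
def IndCarrier : Set (S.GG → W) :=
  {f | (∀ (k : S.GG) (hk : k ∈ C.K) (g : S.GG), f (k * g) = σ ⟨k, hk⟩ (f g)) ∧
       ∃ s : Finset S.GG, ∀ g : S.GG, f g ≠ 0 → ∃ k ∈ C.K, ∃ t ∈ s, g = k * t}

/-- The compact induction `ind_K^G σ`, as a submodule of `G → W`. -/
def IndSub : Submodule 𝔽 (S.GG → W) where
  carrier := IndCarrier C 𝔽 W σ
  add_mem' := by
    rintro f g ⟨hf1, sf, hf2⟩ ⟨hg1, sg, hg2⟩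
    refine ⟨fun k hk x => by simp [hf1 k hk x, hg1 k hk x], sf ∪ sg, fun x hx => ?_⟩
    by_cases h : f x ≠ 0
    · obtain ⟨k, hk, t, ht, rfl⟩ := hf2 x h
      exact ⟨k, hk, t, Finset.mem_union_left _ ht, rfl⟩
    · push_neg at h
      have hgx : g x ≠ 0 := by
        intro h0
        apply hx
        simp [Pi.add_apply, h, h0]
      obtain ⟨k, hk, t, ht, rfl⟩ := hg2 x hgx
      exact ⟨k, hk, t, Finset.mem_union_right _ ht, rfl⟩
  zero_mem' := ⟨fun k hk g => by simp, ∅, fun g hg => absurd rfl hg⟩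
  smul_mem' := by
    rintro c f ⟨hf1, sf, hf2⟩
    refine ⟨fun k hk g => by simp [hf1 k hk g], sf, fun x hx => ?_⟩
    refine hf2 x ?_
    intro h0
    apply hx
    simp [h0]

lemma indAct_mem (g : S.GG) {f : S.GG → W} (hf : f ∈ IndCarrier C 𝔽 W σ) :
    (fun x => f (x * g)) ∈ IndCarrier C 𝔽 W σ := by
  obtain ⟨h1, s, h2⟩ := hf
  refine ⟨fun k hk x => ?_, s.image (· * g⁻¹), ?_⟩
  · show f (k * x * g) = _
    rw [mul_assoc]
    exact h1 k hk (x * g)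
  intro x hx
  obtain ⟨k, hk, t, ht, hxg⟩ := h2 (x * g) hx
  refine ⟨k, hk, t * g⁻¹, Finset.mem_image_of_mem _ ht, ?_⟩
  rw [← mul_assoc, ← hxg, mul_assoc, mul_inv_cancel, mul_one]

/-- The representation of `G` on `ind_K^G σ` by right translation. -/
def indRep : Representation 𝔽 S.GG ↥(IndSub C 𝔽 W σ) where
  toFun g :=
    { toFun := fun f => ⟨fun x => (f : S.GG → W) (x * g), indAct_mem C 𝔽 W σ g f.2⟩
      map_add' := fun f1 f2 => Subtype.ext (funext fun x => rfl)
      map_smul' := fun c f => Subtype.ext (funext fun x => rfl) }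
  map_one' := LinearMap.ext fun f => Subtype.ext (funext fun x => by simp [mul_one])
  map_mul' g h := LinearMap.ext fun f => Subtype.ext (funext fun x => by simp [mul_assoc])

/-- The function `[g, v] ∈ ind_K^G σ`: supported on `K g⁻¹`, with value `v` at `g⁻¹`. -/
def stdFn (g : S.GG) (v : W) : S.GG → W :=
  fun x => if h : x * g ∈ C.K then σ ⟨x * g, h⟩ v else 0

/-- The characterization of the family `f_n` (`n ∈ ℤ`) of `I_{1,K}`-invariant elements of
`ind_K^G σ`: `f_n` is supported on `K α⁻ⁿ I_{1,K}` and has value at `α⁻ⁿ` equal to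
`σ(β_K) v₀` for `n > 0` and `v₀` for `n ≤ 0`, where `v₀` is a fixed nonzero vector of
`σ^{I_{1,K}}`. -/
def IsFFamily (v0 : W) (ff : ℤ → ↥(IndSub C 𝔽 W σ)) : Prop :=
  v0 ≠ 0 ∧ (∀ g ∈ C.I1, sigma' C 𝔽 W σ g v0 = v0) ∧
  (∀ (n : ℤ) (g : S.GG), g ∈ C.I1 → indRep C 𝔽 W σ g (ff n) = ff n) ∧
  (∀ (n : ℤ) (x : S.GG), (ff n : S.GG → W) x ≠ 0 →
    ∃ k ∈ C.K, ∃ i ∈ C.I1, x = k * S.alphaE ^ (-n) * i) ∧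
  (∀ n : ℤ, 0 < n → (ff n : S.GG → W) (S.alphaE ^ (-n)) = sigma' C 𝔽 W σ C.βK v0) ∧
  (∀ n : ℤ, n ≤ 0 → (ff n : S.GG → W) (S.alphaE ^ (-n)) = v0)

/-- The characterization of the Hecke operator `T ∈ End_G(ind_K^G σ)`:
it is `G`-equivariant and satisfies
`T [1, v] = ∑_{u ∈ N_{n_K}/N_{n_K+2}} [u α⁻¹, j_σ σ(u⁻¹) v]
  + ∑_{u ∈ N_{n_K+1}/N_{n_K+2}} [β_K u α⁻¹, j_σ σ(β_K) v]`. -/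
def IsHeckeT (jσ : W →ₗ[𝔽] W) (T : Module.End 𝔽 ↥(IndSub C 𝔽 W σ)) : Prop :=
  (∀ (g : S.GG) (x : ↥(IndSub C 𝔽 W σ)),
    T (indRep C 𝔽 W σ g x) = indRep C 𝔽 W σ g (T x)) ∧
  (∀ (v : W) (x : ↥(IndSub C 𝔽 W σ)), (x : S.GG → W) = stdFn C 𝔽 W σ 1 v →
    ∀ (U2 U1 : Finset S.GG),
      S.IsReps (S.Nk C.nK) (S.Nk (C.nK + 2)) U2 →
      S.IsReps (S.Nk (C.nK + 1)) (S.Nk (C.nK + 2)) U1 →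
      ((T x : S.GG → W)) =
        (∑ u ∈ U2, stdFn C 𝔽 W σ (u * S.alphaE⁻¹) (jσ (sigma' C 𝔽 W σ u⁻¹ v))) +
        ∑ u ∈ U1, stdFn C 𝔽 W σ (C.βK * u * S.alphaE⁻¹) (jσ (sigma' C 𝔽 W σ C.βK v)))

/-- The eigencharacter `χ_σ` of `H₀/H₁` afforded by the (one-dimensional) space
`σ^{I_{1,K}}` with chosen basis vector `v₀`. -/
def IsChi (v0 : W) (χ : S.GG → 𝔽) : Prop :=
  (∀ h ∈ C.H0, sigma' C 𝔽 W σ h v0 = χ h • v0)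

/-- Right translation on functions `K → 𝔽` (the action on a (finite) principal series). -/
def PSact (k : ↥C.K) (f : ↥C.K → 𝔽) : ↥C.K → 𝔽 := fun x => f (x * k)

/-- The (inflation to `K` of the) finite principal series `Ind_𝔹^{Γ_K} χ`:
functions on `K`, invariant under right translation by `K¹`, left `I_{1,K}`-invariant and
left `(H₀, χ)`-equivariant. -/
def PSchiSub (χ : S.GG → 𝔽) : Submodule 𝔽 (↥C.K → 𝔽) where
  carrier := {f | (∀ b : ↥C.K, (b : S.GG) ∈ C.I1 → ∀ x, f (b * x) = f x) ∧
                  (∀ h : ↥C.K, (h : S.GG) ∈ C.H0 → ∀ x, f (h * x) = χ (h : S.GG) * f x) ∧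
                  (∀ z : ↥C.K, (z : S.GG) ∈ C.KoneS → ∀ x, f (x * z) = f x)}
  add_mem' := by
    rintro f g ⟨hf1, hf2, hf3⟩ ⟨hg1, hg2, hg3⟩
    exact ⟨fun b hb x => by simp [hf1 b hb x, hg1 b hb x],
           fun h hh x => by simp [hf2 h hh x, hg2 h hh x, mul_add],
           fun z hz x => by simp [hf3 z hz x, hg3 z hz x]⟩
  zero_mem' := ⟨fun b hb x => rfl, fun h hh x => by simp, fun z hz x => rfl⟩
  smul_mem' := by
    rintro c f ⟨hf1, hf2, hf3⟩
    refine ⟨fun b hb x => by simp [hf1 b hb x], fun h hh x => ?_, fun z hz x => by simp [hf3 z hz x]⟩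
    simp only [Pi.smul_apply, hf2 h hh x, smul_eq_mul]
    ring

/-- The principal series `Ind_𝔹^{Γ_K} 1` for the trivial character. -/
def PS1sub : Submodule 𝔽 (↥C.K → 𝔽) := PSchiSub C 𝔽 (fun _ => 1)

/-- `σ_{st}` is the Steinberg weight `st = (Ind_𝔹^{Γ_K} 1)/1`: there is a surjective
`K`-equivariant linear map from `Ind_𝔹^{Γ_K} 1` to it whose kernel is exactly the
constant functions. -/
def IsSteinberg {Wst : Type} [AddCommGroup Wst] [Module 𝔽 Wst]
    (σst : Representation 𝔽 ↥C.K Wst) : Prop :=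
  ∃ φ : ↥(PS1sub C 𝔽) →ₗ[𝔽] Wst, Function.Surjective φ ∧
    (∀ f : ↥(PS1sub C 𝔽), φ f = 0 ↔ ∃ c : 𝔽, (f : ↥C.K → 𝔽) = fun _ => c) ∧
    (∀ (k : ↥C.K) (f f' : ↥(PS1sub C 𝔽)),
      (f' : ↥C.K → 𝔽) = PSact C 𝔽 k (f : ↥C.K → 𝔽) → φ f' = σst k (φ f))

/-- `σ` is isomorphic to a twist of the Steinberg weight by a character. -/
def IsTwistSteinberg : Prop :=
  ∃ (c : ↥C.K →* 𝔽ˣ) (φ : ↥(PS1sub C 𝔽) →ₗ[𝔽] W), Function.Surjective φ ∧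
    (∀ f : ↥(PS1sub C 𝔽), φ f = 0 ↔ ∃ cc : 𝔽, (f : ↥C.K → 𝔽) = fun _ => cc) ∧
    (∀ (k : ↥C.K) (f f' : ↥(PS1sub C 𝔽)),
      (f' : ↥C.K → 𝔽) = PSact C 𝔽 k (f : ↥C.K → 𝔽) →
        φ f' = (c k : 𝔽) • σ k (φ f))


/-- The `K`-subrepresentation of the quotient `(ind_K^G σ) / (range T)` generated by the
image of a vector `v`. -/
def genQuot (T : Module.End 𝔽 ↥(IndSub C 𝔽 W σ)) (v : ↥(IndSub C 𝔽 W σ)) :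
    Submodule 𝔽 (↥(IndSub C 𝔽 W σ) ⧸ LinearMap.range T) :=
  Submodule.span 𝔽 {w | ∃ k ∈ C.K, w = Submodule.Quotient.mk (indRep C 𝔽 W σ k v)}

end Weight

/-- Smoothness of a representation of `G`: every vector is fixed by some congruence
subgroup (equivalently, has open stabilizer). -/
def SmoothRep {V : Type} [AddCommGroup V] [Module 𝔽 V] (ρ : Representation 𝔽 S.GG V) : Prop :=
  ∀ v : V, ∃ n : ℕ, ∀ g ∈ S.cong n, ρ g v = v

end RepTheory

end U21

namespace U21

namespace Setting

variable (S : Setting)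

section Ideals

variable {S}

lemma mem_pE_zero {z : S.E} : z ∈ S.pE 0 ↔ z ∈ S.O := by
  simp [pE]

lemma pE_add {k : ℤ} {a b : S.E} (ha : a ∈ S.pE k) (hb : b ∈ S.pE k) : a + b ∈ S.pE k := by
  obtain ⟨u, hu, rfl⟩ := ha
  obtain ⟨v, hv, rfl⟩ := hb
  exact ⟨u + v, S.O.add_mem hu hv, by ring⟩

lemma pE_neg {k : ℤ} {a : S.E} (ha : a ∈ S.pE k) : -a ∈ S.pE k := by
  obtain ⟨u, hu, rfl⟩ := ha
  exact ⟨-u, S.O.neg_mem hu, by ring⟩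

lemma pE_mul {k l : ℤ} {a b : S.E} (ha : a ∈ S.pE k) (hb : b ∈ S.pE l) :
    a * b ∈ S.pE (k + l) := by
  obtain ⟨u, hu, rfl⟩ := ha
  obtain ⟨v, hv, rfl⟩ := hb
  exact ⟨u * v, S.O.mul_mem hu hv, by rw [zpow_add₀ S.unif_ne]; ring⟩

lemma zpow_mem_pE (k : ℤ) : S.ϖ ^ k ∈ S.pE k := ⟨1, S.O.one_mem, by ring⟩

lemma pE_mono {k l : ℤ} (h : l ≤ k) {a : S.E} (ha : a ∈ S.pE k) : a ∈ S.pE l := by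
  obtain ⟨u, hu, rfl⟩ := ha
  obtain ⟨n, rfl⟩ := Int.le.dest h
  refine ⟨S.ϖ ^ n * u, S.O.mul_mem (S.O.pow_mem S.unif_mem n) hu, ?_⟩
  rw [zpow_add₀ S.unif_ne, zpow_natCast]; ring

lemma pE_conj {k : ℤ} {a : S.E} (ha : a ∈ S.pE k) : S.conj a ∈ S.pE k := by
  obtain ⟨u, hu, rfl⟩ := ha
  exact ⟨S.conj u, S.conj_O u hu, by simp [S.unif_conj]⟩

lemma unif_mul_ne_one {w : S.E} (hw : w ∈ S.O) : S.ϖ * w ≠ 1 := fun h =>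
  S.unif_not_unit (IsUnit.of_mul_eq_one ⟨w, hw⟩ (Subtype.ext h))

lemma le_of_unit_mul_zpow_mem {k n : ℤ} (u : S.Oˣ) (h : ((u : S.O) : S.E) * S.ϖ ^ n ∈ S.pE k) :
    k ≤ n := by
  by_contra! hlt
  obtain ⟨v, hv, hvn⟩ := pE_mono (show n + 1 ≤ k by omega) h
  have huv : (((u⁻¹ : S.Oˣ) : S.O) : S.E) * ((u : S.O) : S.E) = 1 := by
    rw [← Subring.coe_mul, Units.inv_mul, Subring.coe_one]
  have hcancel : ((u : S.O) : S.E) = S.ϖ * v := by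
    rw [zpow_add₀ S.unif_ne, zpow_one] at hvn
    exact mul_right_cancel₀ (zpow_ne_zero n S.unif_ne) (by rw [hvn]; ring)
  refine unif_mul_ne_one (S.O.mul_mem hv ((u⁻¹ : S.Oˣ) : S.O).2) ?_
  rw [← mul_assoc, ← hcancel, mul_comm, huv]

lemma mem_pE_of_mul_conj_mem {k j : ℤ} (hj : 2 * j ≤ k + 1) {x : S.E}
    (h : x * S.conj x ∈ S.pE k) : x ∈ S.pE j := by
  by_cases hx : x = 0
  · exact ⟨0, S.O.zero_mem, by simp [hx]⟩
  obtain ⟨n, u, rfl⟩ := S.disc x hx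
  have hkn : k ≤ n + n := by
    let c : S.O →+* S.O := S.conj.restrict S.O S.O S.conj_O
    refine le_of_unit_mul_zpow_mem (u * Units.map c.toMonoidHom u) ?_
    convert h using 1
    have hc : ((c (u : S.O) : S.O) : S.E) = S.conj ((u : S.O) : S.E) := rfl
    simp [hc, S.unif_conj, zpow_add₀ S.unif_ne]
    ring
  exact pE_mono (by omega) ⟨_, (u : S.O).2, mul_comm _ _⟩

lemma inv_mem_of_sub_one_mem {e : S.E} (h : e - 1 ∈ S.pE 1) : e ≠ 0 ∧ e⁻¹ ∈ S.O := by
  have hnot : e ∉ S.pE 1 := by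
    intro he
    obtain ⟨w, hw, hw'⟩ := pE_add he (pE_neg h)
    refine unif_mul_ne_one hw ?_
    rw [zpow_one] at hw'
    rw [← hw']; ring
  have he : e ≠ 0 := fun h0 => hnot ⟨0, S.O.zero_mem, by simp [h0]⟩
  refine ⟨he, ?_⟩
  obtain ⟨n, u, rfl⟩ := S.disc e he
  have hn : n ≤ 0 := by
    by_contra! hn
    exact hnot (pE_mono hn ⟨_, (u : S.O).2, mul_comm _ _⟩)
  have hinv : (((u : S.O) : S.E))⁻¹ = (((u⁻¹ : S.Oˣ) : S.O) : S.E) := by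
    refine inv_eq_of_mul_eq_one_left ?_
    rw [← Subring.coe_mul, Units.inv_mul, Subring.coe_one]
  rw [mul_inv, hinv, ← zpow_neg, ← mem_pE_zero]
  exact pE_mono (by omega) ⟨_, ((u⁻¹ : S.Oˣ) : S.O).2, mul_comm _ _⟩

/-- There are trace-zero elements of every valuation. -/
lemma exists_trace_zero (k : ℤ) : ∃ y ∈ S.pE k, y ∉ S.pE (k + 1) ∧ y + S.conj y = 0 := by
  obtain ⟨x, hx⟩ : ∃ x, S.conj x ≠ x := by
    by_contra! h
    exact S.conj_ne (RingHom.ext h)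
  obtain ⟨n, u, hu⟩ := S.disc (x - S.conj x) (sub_ne_zero.2 hx.symm)
  have hval : (x - S.conj x) * S.ϖ ^ (k - n) = ((u : S.O) : S.E) * S.ϖ ^ k := by
    rw [hu, mul_assoc, ← zpow_add₀ S.unif_ne]; congr 2; ring
  refine ⟨(x - S.conj x) * S.ϖ ^ (k - n), ?_, ?_, ?_⟩
  · rw [hval]
    exact ⟨_, (u : S.O).2, mul_comm _ _⟩
  · rw [hval]
    intro h
    have := le_of_unit_mul_zpow_mem u h
    omega
  · simp [S.unif_conj, S.conj_invol]; ring

lemma card_residue_mul_mem {k : ℤ} {y : S.E} (hy : y ∈ S.pE k) :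
    ((S.q ^ 2 : ℕ) : S.E) * y ∈ S.pE (k + 1) := by
  have h0 : S.resmap ((S.q ^ 2 : ℕ) : S.O) = 0 := by
    rw [map_natCast, ← S.card_res]
    exact Nat.cast_card_eq_zero _
  obtain ⟨z, hz, hz'⟩ := (S.hmI _).1 (Ideal.Quotient.eq_zero_iff_mem.1 h0)
  rw [add_comm]
  refine pE_mul ⟨z, hz, ?_⟩ hy
  simpa using hz'

/-- The leading coefficient of an element of `p_E ^ k`. -/
def lead (k : ℤ) (z : S.E) : S.kE :=
  if h : S.ϖ ^ (-k) * z ∈ S.O then S.resmap ⟨_, h⟩ else 0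

lemma sub_mem_of_lead_eq {k : ℤ} {a b : S.E} (ha : a ∈ S.pE k) (hb : b ∈ S.pE k)
    (h : lead k a = lead k b) : a - b ∈ S.pE (k + 1) := by
  have hO : ∀ {z}, z ∈ S.pE k → S.ϖ ^ (-k) * z ∈ S.O := fun hz => by
    have := pE_mul (zpow_mem_pE (-k)) hz
    rwa [neg_add_cancel, mem_pE_zero] at this
  rw [lead, lead, dif_pos (hO ha), dif_pos (hO hb)] at h
  obtain ⟨z, hz, hz'⟩ := (S.hmI _).1 (Ideal.Quotient.eq.1 h)
  refine ⟨z, hz, ?_⟩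
  have hk : S.ϖ ^ k * S.ϖ ^ (-k) = 1 := by
    rw [← zpow_add₀ S.unif_ne, add_neg_cancel, zpow_zero]
  have hz2 : S.ϖ ^ (-k) * a - S.ϖ ^ (-k) * b = S.ϖ * z := hz'
  calc a - b = S.ϖ ^ k * (S.ϖ ^ (-k) * a - S.ϖ ^ (-k) * b) := by
        rw [← mul_sub, ← mul_assoc, hk, one_mul]
    _ = _ := by rw [hz2, zpow_add₀ S.unif_ne, zpow_one, mul_assoc]

end Ideals

section Matrices

variable {S}

lemma mat_mul (a b : S.GG) : S.mat (a * b) = S.mat a * S.mat b := rfl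

lemma mat_one : S.mat 1 = 1 := rfl

lemma mat_injective : Function.Injective S.mat := fun _ _ h => Subtype.ext (Units.ext h)

lemma mat_alpha : S.mat S.alphaE = S.alphaM := rfl

lemma mat_alpha_inv : S.mat S.alphaE⁻¹ = S.alphaMinv := rfl

lemma mat_beta : S.mat S.betaE = S.betaM := rfl

lemma mat_inv_of_mul_eq_one {g : S.GG} {A : S.M3} (h : A * S.mat g = 1) : S.mat g⁻¹ = A := by
  have h1 : S.mat g * S.mat g⁻¹ = 1 := by rw [← mat_mul, mul_inv_cancel, mat_one]
  calc S.mat g⁻¹ = A * S.mat g * S.mat g⁻¹ := by rw [h, one_mul]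
    _ = A := by rw [mul_assoc, h1, mul_one]

/-- The rows of an element of `G` satisfy the same Hermitian relations as its columns. -/
lemma row_relation (g : S.GG) :
    S.mat g * S.betaM * ((S.mat g).map S.conj).transpose = S.betaM := by
  have h : (S.mat g).transpose * S.betaM * (S.mat g).map S.conj = S.betaM := g.2
  have h1 : S.betaM * (S.mat g).transpose * S.betaM * (S.mat g).map S.conj = 1 := by
    rw [mul_assoc, mul_assoc, ← mul_assoc _ S.betaM, h, S.beta_mul_beta]
  have h2 := mul_eq_one_comm.1 h1
  have h3 : (S.mat g).map S.conj * S.betaM * (S.mat g).transpose = S.betaM := by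
    calc _ = (S.mat g).map S.conj * (S.betaM * (S.mat g).transpose * S.betaM) * S.betaM := by
          simp only [mul_assoc, S.beta_mul_beta, mul_one]
      _ = S.betaM := by rw [h2, one_mul]
  have h4 := congrArg Matrix.transpose h3
  have hb : S.betaM.transpose = S.betaM := by
    ext i j; fin_cases i <;> fin_cases j <;> rfl
  rw [Matrix.transpose_mul, Matrix.transpose_mul, Matrix.transpose_transpose, hb,
    ← mul_assoc] at h4
  exact h4

lemma row_relation_apply (g : S.GG) (r s : Fin 3) :
    S.mat g r 0 * S.conj (S.mat g s 2) + S.mat g r 1 * S.conj (S.mat g s 1) +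
      S.mat g r 2 * S.conj (S.mat g s 0) = S.betaM r s := by
  have h := congrFun (congrFun (row_relation g) r) s
  rw [← h]
  simp [Matrix.mul_apply, Fin.sum_univ_three, betaM]
  ring

lemma nM_mul (x y x' y' : S.E) :
    S.nM x y * S.nM x' y' = S.nM (x + x') (y + y' - x * S.conj x') := by
  ext i j
  fin_cases i <;> fin_cases j <;>
    simp [nM, Matrix.mul_apply, Fin.sum_univ_three] <;> ring

lemma nM_zero : S.nM 0 0 = 1 := by
  ext i j
  fin_cases i <;> fin_cases j <;> simp [nM]

/-- The element `n(x,y)` of `G`. -/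
def nE (x y : S.E) (h : x * S.conj x + y + S.conj y = 0) : S.GG :=
  ⟨⟨S.nM x y, S.nM (-x) (S.conj y),
      by rw [nM_mul, ← nM_zero]; congr 1
         · ring
         · rw [map_neg]; linear_combination h,
      by rw [nM_mul, ← nM_zero]; congr 1
         · ring
         · linear_combination h⟩, by
    change (S.nM x y).transpose * S.betaM * (S.nM x y).map S.conj = S.betaM
    ext i j
    fin_cases i <;> fin_cases j <;>
      simp [nM, betaM, Matrix.mul_apply, Fin.sum_univ_three, S.conj_invol]
    linear_combination h⟩

lemma mat_nE {x y : S.E} (h : x * S.conj x + y + S.conj y = 0) : S.mat (nE x y h) = S.nM x y := rfl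

lemma alpha_conj_apply (g : S.GG) : S.mat (S.alphaE⁻¹ * g * S.alphaE) =
    !![S.mat g 0 0, S.ϖ * S.mat g 0 1, S.ϖ ^ 2 * S.mat g 0 2;
       S.ϖ⁻¹ * S.mat g 1 0, S.mat g 1 1, S.ϖ * S.mat g 1 2;
       S.ϖ⁻¹ ^ 2 * S.mat g 2 0, S.ϖ⁻¹ * S.mat g 2 1, S.mat g 2 2] := by
  have := S.unif_ne
  rw [mat_mul, mat_mul, mat_alpha, mat_alpha_inv]
  ext i j
  fin_cases i <;> fin_cases j <;>
    simp [alphaM, alphaMinv, Matrix.mul_apply, Fin.sum_univ_three, Matrix.vecMul, dotProduct] <;>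
    field_simp

lemma alpha_conj_nM (x y : S.E) : S.alphaM * S.nM x y * S.alphaMinv =
    S.nM (S.ϖ⁻¹ * x) (S.ϖ⁻¹ ^ 2 * y) := by
  have := S.unif_ne
  ext i j
  fin_cases i <;> fin_cases j <;>
    simp [alphaM, alphaMinv, nM, Matrix.mul_apply, Fin.sum_univ_three, S.unif_conj] <;> field_simp

lemma beta_conj_nM (x y : S.E) : S.betaM * S.nM x y * S.betaM = S.n'M (-S.conj x) y := by
  ext i j
  fin_cases i <;> fin_cases j <;>
    simp [betaM, nM, n'M, Matrix.mul_apply, Fin.sum_univ_three, S.conj_invol]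

lemma betaPr_conj_nM (x y : S.E) :
    S.betaM * S.alphaMinv * S.nM x y * (S.betaM * S.alphaMinv) =
      S.n'M (-(S.ϖ * S.conj x)) (S.ϖ ^ 2 * y) := by
  have := S.unif_ne
  ext i j
  fin_cases i <;> fin_cases j <;>
    simp [betaM, alphaMinv, nM, n'M, Matrix.mul_apply, Fin.sum_univ_three, S.conj_invol,
      S.unif_conj] <;> field_simp

end Matrices

end Setting

namespace Setting

variable {S : Setting}

lemma mem_Nk_iff_of_mat {k : ℤ} {g : S.GG} {x y : S.E} (hg : S.mat g = S.nM x y)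
    (h : x * S.conj x + y + S.conj y = 0) : g ∈ S.Nk k ↔ y ∈ S.pE k := by
  refine ⟨?_, fun hy => ⟨x, y, h, hy, hg⟩⟩
  rintro ⟨x', y', -, hy', hg'⟩
  have := congrFun (congrFun (hg.symm.trans hg') 0) 2
  simp only [nM, Matrix.of_apply, Matrix.cons_val] at this
  rwa [this]

lemma mul_conj_mem {k : ℤ} {x y : S.E} (h : x * S.conj x + y + S.conj y = 0) (hy : y ∈ S.pE k) :
    x * S.conj x ∈ S.pE k := by
  have : x * S.conj x = -(y + S.conj y) := by linear_combination h
  rw [this]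
  exact pE_neg (pE_add hy (pE_conj hy))

lemma fst_mem {k j : ℤ} (hj : 2 * j ≤ k + 1) {x y : S.E} (h : x * S.conj x + y + S.conj y = 0)
    (hy : y ∈ S.pE k) : x ∈ S.pE j :=
  mem_pE_of_mul_conj_mem hj (mul_conj_mem h hy)

lemma fst_mul_conj_mem {k l m : ℤ} (hm : m ≤ (k + 1) / 2 + (l + 1) / 2) {x y x' y' : S.E}
    (h : x * S.conj x + y + S.conj y = 0) (hy : y ∈ S.pE k)
    (h' : x' * S.conj x' + y' + S.conj y' = 0) (hy' : y' ∈ S.pE l) :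
    x * S.conj x' ∈ S.pE m :=
  pE_mono hm (pE_mul (fst_mem (j := (k + 1) / 2) (by omega) h hy)
    (pE_conj (fst_mem (j := (l + 1) / 2) (by omega) h' hy')))

lemma mat_inv_of_mat_eq_nM {g : S.GG} {x y : S.E} (hg : S.mat g = S.nM x y)
    (h : x * S.conj x + y + S.conj y = 0) : S.mat g⁻¹ = S.nM (-x) (S.conj y) := by
  refine mat_inv_of_mul_eq_one ?_
  rw [hg, nM_mul, ← nM_zero]
  congr 1
  · ring
  · linear_combination h

lemma relation_inv {x y : S.E} (h : x * S.conj x + y + S.conj y = 0) :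
    (-x) * S.conj (-x) + S.conj y + S.conj (S.conj y) = 0 := by
  rw [map_neg, S.conj_invol]; linear_combination h

lemma relation_mul {x y x' y' : S.E} (h : x * S.conj x + y + S.conj y = 0)
    (h' : x' * S.conj x' + y' + S.conj y' = 0) :
    (x + x') * S.conj (x + x') + (y + y' - x * S.conj x') +
      S.conj (y + y' - x * S.conj x') = 0 := by
  simp only [map_add, map_sub, map_mul, S.conj_invol]; linear_combination h + h'

/-- `N_k` as a subgroup of `G`. -/
def NkSubgroup (k : ℤ) : Subgroup S.GG where
  carrier := S.Nk k
  one_mem' := ⟨0, 0, by simp, ⟨0, S.O.zero_mem, by simp⟩, by rw [mat_one, nM_zero]⟩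
  mul_mem' := by
    rintro a b ⟨x, y, h, hy, ha⟩ ⟨x', y', h', hy', hb⟩
    refine ⟨_, _, relation_mul h h', ?_, by rw [mat_mul, ha, hb, nM_mul]⟩
    rw [sub_eq_add_neg]
    exact pE_add (pE_add hy hy') (pE_neg (fst_mul_conj_mem (by omega) h hy h' hy'))
  inv_mem' := by
    rintro a ⟨x, y, h, hy, ha⟩
    exact ⟨_, _, relation_inv h, pE_conj hy, mat_inv_of_mat_eq_nM ha h⟩

lemma NkSubgroup_mono {k l : ℤ} (h : l ≤ k) : S.NkSubgroup k ≤ S.NkSubgroup l := by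
  rintro g ⟨x, y, hr, hy, hg⟩
  exact ⟨x, y, hr, pE_mono h hy, hg⟩

instance NkSubgroup_finite_quotient (k : ℤ) :
    Finite (S.NkSubgroup k ⧸ (S.NkSubgroup (k + 1)).subgroupOf (S.NkSubgroup k)) := by
  let f : S.GG → S.kE × S.kE := fun g =>
    (lead ((k + 1) / 2) (S.mat g 0 1), lead k (S.mat g 0 2))
  refine Finite.of_injective
    (fun c : S.NkSubgroup k ⧸ (S.NkSubgroup (k + 1)).subgroupOf (S.NkSubgroup k) =>
      f (Quotient.out c : S.NkSubgroup k)) fun a b hab => ?_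
  rw [← Quotient.out_eq a, ← Quotient.out_eq b]
  refine QuotientGroup.eq.2 (Subgroup.mem_subgroupOf.2 ?_)
  obtain ⟨x, y, h, hy, ha⟩ := (Quotient.out a).2
  obtain ⟨x', y', h', hy', hb⟩ := (Quotient.out b).2
  have hx := fst_mem (j := (k + 1) / 2) (by omega) h hy
  have hx' := fst_mem (j := (k + 1) / 2) (by omega) h' hy'
  simp only [f, ha, hb, nM, Prod.mk.injEq, Matrix.of_apply, Matrix.cons_val] at hab
  have hdx := sub_mem_of_lead_eq hx hx' hab.1
  have hdy := sub_mem_of_lead_eq hy hy' hab.2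
  refine ⟨_, _, relation_mul (relation_inv h) h', ?_, by
    rw [Subgroup.coe_mul, Subgroup.coe_inv, mat_mul, mat_inv_of_mat_eq_nM ha h, hb, nM_mul]⟩
  have key : S.conj y + y' - -x * S.conj x' = -(y - y') + -(x * S.conj (x - x')) := by
    rw [map_sub]; linear_combination h
  rw [key]
  exact pE_add (pE_neg hdy) (pE_neg (pE_mono (by omega) (pE_mul hx (pE_conj hdx))))

instance NkSubgroup_normal (k : ℤ) :
    ((S.NkSubgroup (k + 1)).subgroupOf (S.NkSubgroup k)).Normal := by
  refine ⟨fun n hn g => ?_⟩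
  rw [Subgroup.mem_subgroupOf] at hn ⊢
  obtain ⟨x', y', h', hy', hn'⟩ := hn
  obtain ⟨x, y, h, hy, hg'⟩ := g.2
  have hinv := mat_inv_of_mat_eq_nM hg' h
  refine ⟨_, _, relation_mul (relation_mul h h') (relation_inv h), ?_, by
    rw [Subgroup.coe_mul, Subgroup.coe_mul, Subgroup.coe_inv, mat_mul, mat_mul, hinv, hg', hn',
      nM_mul, nM_mul]⟩
  have key : y + y' - x * S.conj x' + S.conj y - (x + x') * S.conj (-x) =
      y' + (-(x * S.conj x') + x' * S.conj x) := by
    rw [map_neg]; linear_combination h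
  rw [key]
  exact pE_add hy' (pE_add (pE_neg (fst_mul_conj_mem (by omega) h hy h' hy'))
    (fst_mul_conj_mem (by omega) h' hy' h hy))

lemma mat_pow_of_mat_eq_nM_zero {g : S.GG} {y : S.E} (hg : S.mat g = S.nM 0 y) (n : ℕ) :
    S.mat (g ^ n) = S.nM 0 (n * y) := by
  induction n with
  | zero => simp [mat_one, nM_zero]
  | succ n ih =>
    rw [pow_succ, mat_mul, ih, hg, nM_mul]
    congr 1
    · ring
    · push_cast; ring

lemma prime_dvd_card_quotient (k : ℤ) :
    S.p ∣ Nat.card (S.NkSubgroup k ⧸ (S.NkSubgroup (k + 1)).subgroupOf (S.NkSubgroup k)) := by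
  obtain ⟨y, hy, hy', hr⟩ := exists_trace_zero (S := S) k
  have h : (0 : S.E) * S.conj 0 + y + S.conj y = 0 := by simpa using hr
  let g : S.NkSubgroup k := ⟨nE 0 y h, 0, y, h, hy, rfl⟩
  let c : S.NkSubgroup k ⧸ (S.NkSubgroup (k + 1)).subgroupOf (S.NkSubgroup k) := g
  have hc1 : c ≠ 1 := by
    intro hc
    have := Subgroup.mem_subgroupOf.1 ((QuotientGroup.eq_one_iff g).1 hc)
    exact hy' ((mem_Nk_iff_of_mat rfl h).1 this)
  have hcp : c ^ (S.p ^ (S.fdeg * 2)) = 1 := by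
    refine (QuotientGroup.eq_one_iff (g ^ (S.p ^ (S.fdeg * 2)))).2 (Subgroup.mem_subgroupOf.2 ?_)
    rw [pow_mul, ← S.hq]
    refine ⟨0, _, ?_, card_residue_mul_mem hy, mat_pow_of_mat_eq_nM_zero (mat_nE h) _⟩
    simp only [map_mul, map_natCast, map_zero]
    linear_combination ((S.q ^ 2 : ℕ) : S.E) * hr
  obtain ⟨m, -, hm⟩ := (Nat.dvd_prime_pow S.hp).1 (orderOf_dvd_of_pow_eq_one hcp)
  have hm0 : m ≠ 0 := by
    rintro rfl
    exact hc1 (orderOf_eq_one_iff.1 (by simpa using hm))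
  exact ((dvd_pow_self S.p hm0).trans hm.symm.dvd).trans (orderOf_dvd_natCard c)

lemma exists_isReps (A B : Subgroup S.GG) [Finite (A ⧸ B.subgroupOf A)] :
    ∃ U : Finset S.GG, S.IsReps A B U ∧ U.card = Nat.card (A ⧸ B.subgroupOf A) := by
  have := Fintype.ofFinite (A ⧸ B.subgroupOf A)
  let r : A ⧸ B.subgroupOf A → S.GG := fun c => (Quotient.out c : A)
  have hr : ∀ a : A, ∀ c, (a : S.GG)⁻¹ * r c ∈ B ↔ (a : A ⧸ B.subgroupOf A) = c := fun a c => by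
    conv_rhs => rw [← Quotient.out_eq c]
    exact (QuotientGroup.eq.trans Subgroup.mem_subgroupOf).symm
  have hinj : Function.Injective r := fun c d hcd => by
    have h1 := (hr (Quotient.out c) c).1 (by simp [r])
    have h2 := (hr (Quotient.out c) d).1 (by rw [← hcd]; simp [r])
    exact h1.symm.trans h2
  refine ⟨Finset.univ.image r, ⟨?_, fun a ha => ⟨r (⟨a, ha⟩ : A), ⟨?_, ?_⟩, ?_⟩⟩, ?_⟩
  · intro u hu
    obtain ⟨c, -, rfl⟩ := Finset.mem_image.1 (Finset.mem_coe.1 hu)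
    exact (Quotient.out c).2
  · exact Finset.mem_image_of_mem _ (Finset.mem_univ _)
  · exact (hr ⟨a, ha⟩ _).2 rfl
  · rintro u ⟨hu, hau⟩
    obtain ⟨c, -, rfl⟩ := Finset.mem_image.1 hu
    rw [(hr ⟨a, ha⟩ c).1 hau]
  · rw [Finset.card_image_of_injective _ hinj, Finset.card_univ, Nat.card_eq_fintype_card]

lemma IsReps.eq_of_mem {A B : Subgroup S.GG} {U : Finset S.GG} (hU : S.IsReps A B U)
    {u v : S.GG} (hu : u ∈ U) (hv : v ∈ U) (h : u⁻¹ * v ∈ B) : u = v :=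
  (hU.2 u (hU.1 hu)).unique ⟨hu, by rw [inv_mul_cancel]; exact B.one_mem⟩ ⟨hv, h⟩

lemma IsReps.mul_injOn {A B D : Subgroup S.GG} {U V : Finset S.GG} (hU : S.IsReps A B U)
    (hV : S.IsReps B D V) : Set.InjOn (fun z : S.GG × S.GG => z.1 * z.2) (U ×ˢ V : Finset _) := by
  rintro ⟨u, v⟩ h ⟨u', v'⟩ h' huv
  simp only [Finset.coe_product, Set.mem_prod, Finset.mem_coe] at h h' huv
  have hB : u⁻¹ * u' = v * v'⁻¹ := by
    rw [inv_mul_eq_iff_eq_mul, ← mul_assoc, huv, mul_inv_cancel_right]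
  have hu : u = u' := hU.eq_of_mem h.1 h'.1 (hB ▸ B.mul_mem (hV.1 h.2) (B.inv_mem (hV.1 h'.2)))
  subst hu
  rw [mul_left_cancel huv]

lemma IsReps.mul {A B D : Subgroup S.GG} (hBA : B ≤ A) (hDB : D ≤ B) {U V : Finset S.GG}
    (hU : S.IsReps A B U) (hV : S.IsReps B D V) :
    S.IsReps A D ((U ×ˢ V).image fun z => z.1 * z.2) := by
  refine ⟨?_, fun a ha => ?_⟩
  · intro w hw
    obtain ⟨⟨u, v⟩, huv, rfl⟩ := Finset.mem_image.1 (Finset.mem_coe.1 hw)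
    rw [Finset.mem_product] at huv
    exact A.mul_mem (hU.1 huv.1) (hBA (hV.1 huv.2))
  · obtain ⟨u, ⟨hu, hau⟩, huniq⟩ := hU.2 a ha
    obtain ⟨v, ⟨hv, hav⟩, hvuniq⟩ := hV.2 (u⁻¹ * a) (by simpa using B.inv_mem hau)
    refine ⟨u * v, ⟨Finset.mem_image_of_mem _ (Finset.mk_mem_product hu hv), ?_⟩, ?_⟩
    · simpa [mul_assoc] using hav
    · rintro w ⟨hw, haw⟩
      obtain ⟨⟨u', v'⟩, huv, rfl⟩ := Finset.mem_image.1 hw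
      rw [Finset.mem_product] at huv
      have hu' : u' = u := huniq u' ⟨huv.1, by
        simpa [mul_assoc] using B.mul_mem (hDB haw) (B.inv_mem (hV.1 huv.2))⟩
      subst hu'
      rw [hvuniq v' ⟨huv.2, by simpa [mul_assoc] using haw⟩]

end Setting

namespace Setting

variable {S : Setting}

lemma mat_alpha_conj_of_eq_nM {g : S.GG} {x y : S.E} (hg : S.mat g = S.nM x y) :
    S.mat (S.alphaE * g * S.alphaE⁻¹) = S.nM (S.ϖ⁻¹ * x) (S.ϖ⁻¹ ^ 2 * y) := by
  rw [mat_mul, mat_mul, hg]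
  exact alpha_conj_nM x y

lemma relation_scale {x y : S.E} (h : x * S.conj x + y + S.conj y = 0) :
    S.ϖ⁻¹ * x * S.conj (S.ϖ⁻¹ * x) + S.ϖ⁻¹ ^ 2 * y + S.conj (S.ϖ⁻¹ ^ 2 * y) = 0 := by
  simp only [map_mul, map_pow, map_inv₀, S.unif_conj]
  linear_combination S.ϖ⁻¹ ^ 2 * h

lemma inv_unif_sq_mul_mem_iff {k : ℤ} {y : S.E} : S.ϖ⁻¹ ^ 2 * y ∈ S.pE k ↔ y ∈ S.pE (k + 2) := by
  have h2 : S.ϖ⁻¹ ^ 2 = S.ϖ ^ (-2 : ℤ) := by simp [zpow_neg, zpow_ofNat]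
  rw [h2]
  constructor <;> intro h
  · have := pE_mul (zpow_mem_pE 2) h
    rwa [← mul_assoc, ← zpow_add₀ S.unif_ne, add_neg_cancel, zpow_zero, one_mul, add_comm] at this
  · have := pE_mul (zpow_mem_pE (-2)) h
    rwa [add_comm, add_neg_cancel_right] at this

lemma alpha_conj_mem_Nk_iff {k : ℤ} {g : S.GG} (hg : g ∈ S.Nset) :
    S.alphaE * g * S.alphaE⁻¹ ∈ S.Nk k ↔ g ∈ S.Nk (k + 2) := by
  obtain ⟨x, y, h, hg⟩ := hg
  rw [mem_Nk_iff_of_mat hg h, mem_Nk_iff_of_mat (mat_alpha_conj_of_eq_nM hg) (relation_scale h),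
    inv_unif_sq_mul_mem_iff]

lemma beta_sq : S.betaE * S.betaE = 1 := mat_injective S.beta_mul_beta

lemma beta_alpha_beta : S.betaE * S.alphaE * S.betaE = S.alphaE⁻¹ := by
  refine mat_injective ?_
  rw [mat_mul, mat_mul, mat_beta, mat_alpha, mat_alpha_inv]
  ext i j
  fin_cases i <;> fin_cases j <;>
    simp [alphaM, alphaMinv, betaM, Matrix.mul_apply, Fin.sum_univ_three]

lemma mat_betaPr : S.mat S.betaPr = S.betaM * S.alphaMinv := rfl

/-- Right multiplication by `n'(d̄/ē, c̄/ē)` clears the bottom row `(c, d, e)`. -/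
lemma upper_triangular_of_mul_n'M {g n : S.GG} (he : S.mat g 2 2 ≠ 0)
    (hn : S.mat n = S.n'M (S.conj (S.mat g 2 1) / S.conj (S.mat g 2 2))
      (S.conj (S.mat g 2 0) / S.conj (S.mat g 2 2))) :
    S.mat (g * n) 1 0 = 0 ∧ S.mat (g * n) 2 0 = 0 ∧ S.mat (g * n) 2 1 = 0 := by
  have hec : S.conj (S.mat g 2 2) ≠ 0 := (map_ne_zero _).2 he
  have hrow := row_relation_apply g 2 2
  simp only [betaM, Matrix.of_apply, Matrix.cons_val] at hrow
  have h20 : S.mat (g * n) 2 0 = 0 := by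
    rw [mat_mul, hn]
    simp only [Matrix.mul_apply, Fin.sum_univ_three, n'M, Matrix.of_apply, Matrix.cons_val]
    field_simp
    linear_combination hrow
  have h21 : S.mat (g * n) 2 1 = 0 := by
    rw [mat_mul, hn]
    simp only [Matrix.mul_apply, Fin.sum_univ_three, n'M, Matrix.of_apply, Matrix.cons_val,
      map_div₀, S.conj_invol]
    field_simp
    ring
  have h22 : S.mat (g * n) 2 2 = S.mat g 2 2 := by
    rw [mat_mul, hn]
    simp [Matrix.mul_apply, Fin.sum_univ_three, n'M]
  refine ⟨?_, h20, h21⟩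
  have h := row_relation_apply (g * n) 2 1
  rw [h20, h21, h22] at h
  simpa [betaM, he] using h

lemma relation_bottom_row (g : S.GG) (he : S.mat g 2 2 ≠ 0) :
    -(S.mat g 2 1 / S.mat g 2 2) * S.conj (-(S.mat g 2 1 / S.mat g 2 2)) +
      S.conj (S.mat g 2 0) / S.conj (S.mat g 2 2) +
      S.conj (S.conj (S.mat g 2 0) / S.conj (S.mat g 2 2)) = 0 := by
  have hec : S.conj (S.mat g 2 2) ≠ 0 := (map_ne_zero _).2 he
  have hrow := row_relation_apply g 2 2
  simp only [betaM, Matrix.of_apply, Matrix.cons_val] at hrow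
  simp only [map_neg, map_div₀, S.conj_invol]
  field_simp
  linear_combination hrow

end Setting

namespace Chamber

variable {S : Setting} {C : Chamber S}

open Setting

lemma I1_subset_K {g : S.GG} (hg : g ∈ C.I1) : g ∈ C.K := by
  rw [← SetLike.mem_coe]
  rcases C.cases with ⟨hK, -, -, hI, -⟩ | ⟨hK, -, -, hI, -⟩
  · rw [hI] at hg; rw [hK]; exact hg.1.1
  · rw [hI] at hg; rw [hK]; exact hg.1.1

lemma Nk_subset_K {g : S.GG} (hg : g ∈ S.Nk C.nK) : g ∈ C.K := by
  rw [← SetLike.mem_coe]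
  have h0 : ∀ {k : ℤ}, (0 : S.E) ∈ S.pE k := ⟨0, S.O.zero_mem, by simp⟩
  rcases C.cases with ⟨hK, -, -, -, -, -, hn, -⟩ | ⟨hK, -, -, -, -, -, hn, -⟩
  · rw [hn] at hg; rw [hK]
    obtain ⟨x, y, h, hy, hg⟩ := hg
    have hx := mem_pE_zero.1 (fst_mem (j := 0) (by omega) h hy)
    have hxc := S.O.neg_mem (S.conj_O x hx)
    rw [mem_pE_zero] at hy
    intro i j
    rw [hg]
    fin_cases i <;> fin_cases j <;> simp [nM, S.O.zero_mem, S.O.one_mem, hx, hy]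
    simpa using hxc
  · rw [hn] at hg; rw [hK]
    obtain ⟨x, y, h, hy, hg⟩ := hg
    have hx := mem_pE_zero.1 (fst_mem (j := 0) (by omega) h hy)
    have hxc := S.O.neg_mem (S.conj_O x hx)
    simp only [K1set, Set.mem_ofPred_eq, hg, nM, Matrix.of_apply, Matrix.cons_val]
    exact ⟨S.O.one_mem, hx, hy, h0, S.O.one_mem, hxc, h0, h0, S.O.one_mem⟩

lemma snd_mem_of_nM_mem_K {g : S.GG} {x y : S.E} (hg : S.mat g = S.nM x y) (hK : g ∈ C.K) :
    y ∈ S.pE C.nK := by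
  rw [← SetLike.mem_coe] at hK
  have h02 : S.mat g 0 2 = y := by rw [hg]; rfl
  rcases C.cases with ⟨h, -, -, -, -, -, hn, -⟩ | ⟨h, -, -, -, -, -, hn, -⟩
  · rw [h] at hK; rw [hn, mem_pE_zero, ← h02]; exact hK 0 2
  · rw [h] at hK; rw [hn, ← h02]; exact hK.2.2.1

/-- `N ∩ K = N_{n_K}`, conjugated by `α`. -/
lemma alpha_conj_mem_K_iff {g : S.GG} (hg : g ∈ S.Nset) :
    S.alphaE * g * S.alphaE⁻¹ ∈ C.K ↔ g ∈ S.Nk (C.nK + 2) := by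
  rw [← alpha_conj_mem_Nk_iff hg]
  refine ⟨fun h => ?_, Nk_subset_K⟩
  obtain ⟨x, y, hr, hg⟩ := hg
  have hm := mat_alpha_conj_of_eq_nM hg
  exact (mem_Nk_iff_of_mat hm (relation_scale hr)).2 (snd_mem_of_nM_mem_K hm h)

lemma βK_sq : C.βK * C.βK = 1 := by
  rcases C.cases with ⟨-, -, -, -, -, h, -⟩ | ⟨-, -, -, -, -, h, -⟩
  · rw [h, beta_sq]
  · rw [h, betaPr]
    have := beta_alpha_beta (S := S)
    rw [← inv_inj, inv_inv, mul_inv_rev, mul_inv_rev, eq_comm,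
      inv_eq_of_mul_eq_one_left beta_sq] at this
    rw [← mul_assoc, mul_assoc S.betaE, ← mul_assoc, mul_assoc S.betaE, ← this, mul_inv_cancel]

lemma βK_mem : C.βK ∈ C.K := by
  rw [← SetLike.mem_coe]
  have h0 : ∀ {k : ℤ}, (0 : S.E) ∈ S.pE k := ⟨0, S.O.zero_mem, by simp⟩
  rcases C.cases with ⟨hK, -, -, -, -, h, -⟩ | ⟨hK, -, -, -, -, h, -⟩
  · rw [h, hK]
    intro i j
    rw [mat_beta]
    fin_cases i <;> fin_cases j <;> simp [betaM, S.O.zero_mem, S.O.one_mem]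
  · rw [h, hK]
    have hm : S.mat S.betaPr = !![0, 0, S.ϖ⁻¹; 0, 1, 0; S.ϖ, 0, 0] := by
      rw [mat_betaPr]
      ext i j
      fin_cases i <;> fin_cases j <;>
        simp [betaM, alphaMinv, Matrix.mul_apply, Fin.sum_univ_three]
    simp only [K1set, Set.mem_ofPred_eq, hm, Matrix.of_apply, Matrix.cons_val]
    exact ⟨S.O.zero_mem, S.O.zero_mem, by simpa using zpow_mem_pE (S := S) (-1), h0, S.O.one_mem,
      S.O.zero_mem, by simpa using zpow_mem_pE (S := S) 1, h0, S.O.zero_mem⟩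

lemma βK_mul_alpha_mul_βK : C.βK * S.alphaE * C.βK = S.alphaE⁻¹ := by
  rcases C.cases with ⟨-, -, -, -, -, h, -⟩ | ⟨-, -, -, -, -, h, -⟩
  · rw [h, beta_alpha_beta]
  · rw [h, betaPr, inv_mul_cancel_right, ← mul_assoc, beta_sq, one_mul]

lemma βK_conj_mem_I1 {w : S.GG} (hw : w ∈ S.Nk (C.nK + 1)) : C.βK * w * C.βK ∈ C.I1 := by
  have h0 : ∀ {k : ℤ}, (0 : S.E) ∈ S.pE k := ⟨0, S.O.zero_mem, by simp⟩
  rcases C.cases with ⟨-, -, -, hI, -, h, hn, -⟩ | ⟨-, -, -, hI, -, h, hn, -⟩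
  · rw [hn, zero_add] at hw
    rw [hI, h]
    obtain ⟨x, y, hr, hy, hw⟩ := hw
    have hx := fst_mem (j := 1) (by omega) hr hy
    have hxc := pE_neg (pE_conj hx)
    have hO : ∀ {z}, z ∈ S.pE 1 → z ∈ S.O := fun hz => mem_pE_zero.1 (pE_mono (by omega) hz)
    have hm : S.mat (S.betaE * w * S.betaE) = S.n'M (-S.conj x) y := by
      rw [mat_mul, mat_mul, hw]; exact beta_conj_nM x y
    refine ⟨⟨fun i j => ?_, ?_⟩, ?_⟩
    · rw [hm]
      fin_cases i <;> fin_cases j <;>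
        simp [n'M, S.O.zero_mem, S.O.one_mem, S.conj_invol, hO hx, hO hy]
      simpa using hO hxc
    · simp only [hm, n'M, Matrix.of_apply, Matrix.cons_val, map_neg, S.conj_invol, neg_neg]
      exact ⟨hxc, hy, hx⟩
    · simp only [hm, n'M, Matrix.of_apply, Matrix.cons_val, sub_self]
      exact ⟨h0, h0, h0⟩
  · rw [hn, neg_add_cancel] at hw
    rw [hI, h]
    obtain ⟨x, y, hr, hy, hw⟩ := hw
    have hϖ : S.ϖ ∈ S.pE 1 := by simpa using zpow_mem_pE (S := S) 1
    have hx := fst_mem (j := 0) (by omega) hr hy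
    have hx1 : S.ϖ * x ∈ S.pE 1 := pE_mul hϖ hx
    have hxc : -(S.ϖ * S.conj x) ∈ S.pE 1 := pE_neg (pE_mul hϖ (pE_conj hx))
    have hy2 : S.ϖ ^ 2 * y ∈ S.pE 2 := by
      rw [pow_two]; exact pE_mul (k := 2) (l := 0) (pE_mul (k := 1) (l := 1) hϖ hϖ) hy
    have hm : S.mat (S.betaPr * w * S.betaPr) = S.n'M (-(S.ϖ * S.conj x)) (S.ϖ ^ 2 * y) := by
      rw [mat_mul, mat_mul, hw]; exact betaPr_conj_nM x y
    simp only [I1K1, IK1, K1set, Set.mem_ofPred_eq, hm, n'M, Matrix.of_apply, Matrix.cons_val,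
      map_neg, map_mul, S.unif_conj, S.conj_invol, neg_neg, sub_self]
    exact ⟨⟨⟨S.O.one_mem, S.O.zero_mem, h0, hxc, S.O.one_mem, S.O.zero_mem,
      pE_mono (by omega) hy2, hx1, S.O.one_mem⟩, hy2⟩, h0, h0, h0⟩

lemma alpha_conj_mem_K_of_upper_triangular {g : S.GG} (hg : g ∈ C.K)
    (h : S.mat g 1 0 = 0 ∧ S.mat g 2 0 = 0 ∧ S.mat g 2 1 = 0) :
    S.alphaE⁻¹ * g * S.alphaE ∈ C.K := by
  rw [← SetLike.mem_coe] at hg ⊢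
  have h0 : ∀ {k : ℤ}, (0 : S.E) ∈ S.pE k := ⟨0, S.O.zero_mem, by simp⟩
  obtain ⟨h10, h20, h21⟩ := h
  have hm := alpha_conj_apply g
  rw [h10, h20, h21] at hm
  rcases C.cases with ⟨hK, -⟩ | ⟨hK, -⟩
  · rw [hK] at hg ⊢
    have h1 : ∀ i j, S.ϖ * S.mat g i j ∈ S.O := fun i j => S.O.mul_mem S.unif_mem (hg i j)
    have h2 : ∀ i j, S.ϖ ^ 2 * S.mat g i j ∈ S.O := fun i j =>
      S.O.mul_mem (S.O.pow_mem S.unif_mem 2) (hg i j)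
    have h3 : ∀ i j, S.mat g i j ∈ S.O := hg
    intro i j
    rw [hm]
    fin_cases i <;> fin_cases j <;> simp [S.O.zero_mem, h1, h2, h3]
  · rw [hK] at hg ⊢
    obtain ⟨g00, g01, g02, -, g11, g12, -, -, g22⟩ := hg
    have hϖ2 : S.ϖ ^ 2 ∈ S.pE 2 := by simpa [zpow_ofNat] using zpow_mem_pE (S := S) 2
    simp only [K1set, Set.mem_ofPred_eq, hm, Matrix.of_apply, Matrix.cons_val, mul_zero]
    exact ⟨g00, S.O.mul_mem S.unif_mem g01, pE_mono (by norm_num) (pE_mul hϖ2 g02), h0, g11,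
      S.O.mul_mem S.unif_mem g12, h0, h0, g22⟩

/-- A form of the Iwahori factorization of `I_{1,K}`. -/
lemma exists_Nk_of_mem_I1 {g : S.GG} (hg : g ∈ C.I1) :
    ∃ w ∈ S.Nk (C.nK + 1), S.alphaE⁻¹ * (g * (C.βK * w * C.βK)) * S.alphaE ∈ C.K := by
  have he1 : S.mat g 2 2 - 1 ∈ S.pE 1 := by
    rcases C.cases with ⟨-, -, -, hI, -⟩ | ⟨-, -, -, hI, -⟩ <;>
    · rw [hI] at hg; exact hg.2.2.2
  obtain ⟨he, hei⟩ := inv_mem_of_sub_one_mem he1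
  rw [← mem_pE_zero] at hei
  have hrel := relation_bottom_row g he
  have hdiv : ∀ {k : ℤ} {z}, z ∈ S.pE k → z / S.conj (S.mat g 2 2) ∈ S.pE k := fun hz => by
    rw [div_eq_mul_inv, ← map_inv₀]
    simpa using pE_mul hz (pE_conj hei)
  suffices H : ∃ w ∈ S.Nk (C.nK + 1), S.mat (C.βK * w * C.βK) =
      S.n'M (S.conj (S.mat g 2 1) / S.conj (S.mat g 2 2))
        (S.conj (S.mat g 2 0) / S.conj (S.mat g 2 2)) by
    obtain ⟨w, hw, hm⟩ := H
    exact ⟨w, hw, alpha_conj_mem_K_of_upper_triangular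
      (C.K.mul_mem (I1_subset_K hg) (I1_subset_K (βK_conj_mem_I1 hw)))
      (upper_triangular_of_mul_n'M he hm)⟩
  rcases C.cases with ⟨-, -, -, hI, -, h, hn, -⟩ | ⟨-, -, -, hI, -, h, hn, -⟩
  · rw [hI] at hg
    refine ⟨nE _ _ hrel, ⟨_, _, hrel, ?_, rfl⟩, ?_⟩
    · rw [hn]; exact hdiv (pE_conj hg.1.2.2.1)
    · rw [h, mat_mul, mat_mul, mat_nE, mat_beta, beta_conj_nM, map_neg, neg_neg, map_div₀]
  · rw [hI] at hg
    have hrel' := relation_scale hrel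
    refine ⟨nE _ _ hrel', ⟨_, _, hrel', ?_, rfl⟩, ?_⟩
    · rw [hn, inv_unif_sq_mul_mem_iff]; exact hdiv (pE_conj hg.1.2)
    · have := S.unif_ne
      rw [h, mat_mul, mat_mul, mat_nE, mat_betaPr, betaPr_conj_nM]
      congr 1
      · simp only [map_neg, map_mul, map_inv₀, map_div₀, S.unif_conj]; field_simp
      · field_simp

end Chamber

section TrivialWeight

open Setting Chamber

variable {S : Setting} {C : Chamber S} {𝔽 : Type} [Field 𝔽]

lemma stdFn_one_apply (g x : S.GG) (v : 𝔽) :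
    stdFn C 𝔽 𝔽 (1 : Representation 𝔽 ↥C.K 𝔽) g v x = if x * g ∈ C.K then v else 0 := by
  simp [stdFn]

lemma sigma'_one (g : S.GG) (v : 𝔽) :
    sigma' C 𝔽 𝔽 (1 : Representation 𝔽 ↥C.K 𝔽) g v = v := by
  unfold sigma'; split <;> rfl

variable {v0 : 𝔽} {ff : ℤ → ↥(IndSub C 𝔽 𝔽 (1 : Representation 𝔽 ↥C.K 𝔽))}

lemma IndSub_one_left_invariant (f : ↥(IndSub C 𝔽 𝔽 (1 : Representation 𝔽 ↥C.K 𝔽)))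
    {k : S.GG} (hk : k ∈ C.K) (x : S.GG) : (f : S.GG → 𝔽) (k * x) = (f : S.GG → 𝔽) x := by
  simpa using f.2.1 k hk x

lemma IsFFamily.apply_mul_right (hff : IsFFamily C 𝔽 𝔽 (1 : Representation 𝔽 ↥C.K 𝔽) v0 ff)
    (n : ℤ) {i : S.GG} (hi : i ∈ C.I1) (x : S.GG) :
    (ff n : S.GG → 𝔽) (x * i) = (ff n : S.GG → 𝔽) x :=
  congrFun (congrArg Subtype.val (hff.2.2.1 n i hi)) x

lemma IsFFamily.zero_apply (hff : IsFFamily C 𝔽 𝔽 (1 : Representation 𝔽 ↥C.K 𝔽) v0 ff)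
    (x : S.GG) : (ff 0 : S.GG → 𝔽) x = if x ∈ C.K then v0 else 0 := by
  split_ifs with hx
  · have h1 := IndSub_one_left_invariant (ff 0) hx 1
    have h2 := hff.2.2.2.2.2 0 le_rfl
    rw [neg_zero, zpow_zero] at h2
    rw [← h2, ← h1, mul_one]
  · by_contra h
    obtain ⟨k, hk, i, hi, rfl⟩ := hff.2.2.2.1 0 x h
    rw [neg_zero, zpow_zero, mul_one] at hx
    exact hx (C.K.mul_mem hk (I1_subset_K hi))

/-- `f₁` as a sum of translates of `f₀`. -/
lemma IsFFamily.one_apply (hff : IsFFamily C 𝔽 𝔽 (1 : Representation 𝔽 ↥C.K 𝔽) v0 ff)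
    {U : Finset S.GG} (hU : S.IsReps (S.Nk (C.nK + 1)) (S.Nk (C.nK + 2)) U) (x : S.GG) :
    (ff 1 : S.GG → 𝔽) x =
      ∑ w ∈ U, if x * (C.βK * w * S.alphaE⁻¹) ∈ C.K then v0 else 0 := by
  have hU' : S.IsReps (S.NkSubgroup (C.nK + 1)) (S.NkSubgroup (C.nK + 2)) U := hU
  have hN : ∀ {g : S.GG} {k : ℤ}, g ∈ S.NkSubgroup k → g ∈ S.Nset := by
    rintro g k ⟨a, b, h, -, hg⟩
    exact ⟨a, b, h, hg⟩
  have hββ : ∀ g : S.GG, C.βK * (C.βK * g) = g := fun g => by rw [← mul_assoc, βK_sq, one_mul]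
  have hβα : C.βK * S.alphaE⁻¹ = S.alphaE * C.βK := by
    rw [← βK_mul_alpha_mul_βK (C := C), mul_assoc, hββ]
  have huniq : ∀ w ∈ U, x * (C.βK * w * S.alphaE⁻¹) ∈ C.K → ∀ u ∈ U, u ≠ w →
      x * (C.βK * u * S.alphaE⁻¹) ∉ C.K := by
    intro w hw hxw u hu huw hxu
    refine huw (hU'.eq_of_mem hu hw ?_)
    have hmem : u⁻¹ * w ∈ S.NkSubgroup (C.nK + 1) :=
      Subgroup.mul_mem _ (Subgroup.inv_mem _ (hU.1 hu)) (hU.1 hw)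
    refine (alpha_conj_mem_K_iff (hN hmem)).1 ?_
    convert C.K.mul_mem (C.K.inv_mem hxu) hxw using 1
    group
  by_cases hex : ∃ w ∈ U, x * (C.βK * w * S.alphaE⁻¹) ∈ C.K
  · obtain ⟨w, hw, hxw⟩ := hex
    rw [Finset.sum_eq_single_of_mem w hw fun u hu huw => if_neg (huniq w hw hxw u hu huw),
      if_pos hxw]
    have hi : C.βK * w⁻¹ * C.βK ∈ C.I1 :=
      βK_conj_mem_I1 ((S.NkSubgroup (C.nK + 1)).inv_mem (hU.1 hw))
    have hx : x = x * (C.βK * w * S.alphaE⁻¹) * C.βK * (S.alphaE⁻¹ * (C.βK * w⁻¹ * C.βK)) := by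
      have h1 : S.alphaE⁻¹ * C.βK * S.alphaE⁻¹ = C.βK := by
        rw [mul_assoc, hβα, inv_mul_cancel_left]
      calc x = x * (C.βK * w * (C.βK * (C.βK * (w⁻¹ * C.βK)))) := by
            rw [hββ, mul_assoc C.βK w, mul_inv_cancel_left, βK_sq, mul_one]
        _ = x * (C.βK * w * ((S.alphaE⁻¹ * C.βK * S.alphaE⁻¹) * (C.βK * (w⁻¹ * C.βK)))) := by
            rw [h1]
        _ = _ := by simp only [mul_assoc]
    rw [hx, mul_assoc (x * (C.βK * w * S.alphaE⁻¹)), IndSub_one_left_invariant _ hxw,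
      IndSub_one_left_invariant _ βK_mem, hff.apply_mul_right 1 hi]
    have h2 := hff.2.2.2.2.1 1 one_pos
    rwa [sigma'_one, zpow_neg_one] at h2
  · rw [Finset.sum_eq_zero fun w hw => if_neg fun h => hex ⟨w, hw, h⟩]
    by_contra h
    obtain ⟨k, hk, i, hi, rfl⟩ := hff.2.2.2.1 1 x h
    obtain ⟨w, hw, hwK⟩ := exists_Nk_of_mem_I1 hi
    obtain ⟨u, ⟨hu, hwu⟩, -⟩ := hU.2 w hw
    refine hex ⟨u, hu, ?_⟩
    have hK := (alpha_conj_mem_K_iff (hN (k := C.nK + 2) hwu)).2 hwu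
    convert C.K.mul_mem (C.K.mul_mem (C.K.mul_mem hk hwK) βK_mem) hK using 1
    calc k * S.alphaE ^ (-1 : ℤ) * i * (C.βK * u * S.alphaE⁻¹)
        = k * S.alphaE⁻¹ * i * C.βK * w * (S.alphaE⁻¹ * S.alphaE) * (w⁻¹ * u * S.alphaE⁻¹) := by
          group
      _ = k * S.alphaE⁻¹ * i * C.βK * w * (C.βK * S.alphaE * C.βK * S.alphaE) *
            (w⁻¹ * u * S.alphaE⁻¹) := by rw [βK_mul_alpha_mul_βK]
      _ = _ := by simp only [mul_assoc]

/-- `f₀` generates `ind_K^G 1`. -/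
lemma IsFFamily.orbitSpan_zero (hff : IsFFamily C 𝔽 𝔽 (1 : Representation 𝔽 ↥C.K 𝔽) v0 ff) :
    orbitSpan 𝔽 (indRep C 𝔽 𝔽 (1 : Representation 𝔽 ↥C.K 𝔽)) (ff 0) = ⊤ := by
  have key : ∀ (s : Finset S.GG) (f : ↥(IndSub C 𝔽 𝔽 (1 : Representation 𝔽 ↥C.K 𝔽))),
      (∀ x, (f : S.GG → 𝔽) x ≠ 0 → ∃ k ∈ C.K, ∃ t ∈ s, x = k * t) →
      f ∈ orbitSpan 𝔽 (indRep C 𝔽 𝔽 (1 : Representation 𝔽 ↥C.K 𝔽)) (ff 0) := by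
    intro s
    induction s using Finset.induction_on with
    | empty =>
      intro f hf
      have : f = 0 := by
        ext x
        by_contra hx
        obtain ⟨k, -, t, ht, -⟩ := hf x hx
        exact absurd ht (Finset.notMem_empty t)
      rw [this]
      exact zero_mem _
    | insert t s _ ih =>
      intro f hf
      set e := ((f : S.GG → 𝔽) t / v0) • indRep C 𝔽 𝔽 (1 : Representation 𝔽 ↥C.K 𝔽) t⁻¹ (ff 0)
        with he
      have heval : ∀ x, (e : S.GG → 𝔽) x =
          (f : S.GG → 𝔽) t / v0 * (ff 0 : S.GG → 𝔽) (x * t⁻¹) := fun x => rfl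
      have hmem : e ∈ orbitSpan 𝔽 (indRep C 𝔽 𝔽 (1 : Representation 𝔽 ↥C.K 𝔽)) (ff 0) :=
        Submodule.smul_mem _ _ (Submodule.subset_span ⟨t⁻¹, rfl⟩)
      rw [← sub_add_cancel f e]
      refine add_mem (ih _ fun x hx => ?_) hmem
      have hsub : ((f - e : ↥(IndSub C 𝔽 𝔽 (1 : Representation 𝔽 ↥C.K 𝔽))) : S.GG → 𝔽) x =
        (f : S.GG → 𝔽) x - (e : S.GG → 𝔽) x := rfl
      rw [hsub, heval, hff.zero_apply] at hx
      by_cases hxt : x * t⁻¹ ∈ C.K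
      · refine absurd ?_ hx
        have hft := IndSub_one_left_invariant f hxt t
        rw [inv_mul_cancel_right] at hft
        rw [if_pos hxt, div_mul_cancel₀ _ hff.1, hft, sub_self]
      · rw [if_neg hxt, mul_zero, sub_zero] at hx
        obtain ⟨k, hk, u, hu, rfl⟩ := hf x hx
        rcases Finset.mem_insert.1 hu with rfl | hu
        · exact absurd (by rwa [mul_inv_cancel_right]) hxt
        · exact ⟨k, hk, u, hu, rfl⟩
  refine eq_top_iff.2 fun f _ => ?_
  obtain ⟨s, hs⟩ := f.2.2
  exact key s f hs

lemma indRep_mem_orbitSpan {v w : ↥(IndSub C 𝔽 𝔽 (1 : Representation 𝔽 ↥C.K 𝔽))} (g : S.GG)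
    (hw : w ∈ orbitSpan 𝔽 (indRep C 𝔽 𝔽 (1 : Representation 𝔽 ↥C.K 𝔽)) v) :
    indRep C 𝔽 𝔽 (1 : Representation 𝔽 ↥C.K 𝔽) g w ∈
      orbitSpan 𝔽 (indRep C 𝔽 𝔽 (1 : Representation 𝔽 ↥C.K 𝔽)) v := by
  have hle : orbitSpan 𝔽 (indRep C 𝔽 𝔽 (1 : Representation 𝔽 ↥C.K 𝔽)) v ≤
      (orbitSpan 𝔽 (indRep C 𝔽 𝔽 (1 : Representation 𝔽 ↥C.K 𝔽)) v).comap
        (indRep C 𝔽 𝔽 (1 : Representation 𝔽 ↥C.K 𝔽) g) := by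
    refine Submodule.span_le.2 ?_
    rintro _ ⟨h, rfl⟩
    exact Submodule.subset_span ⟨g * h, by rw [map_mul]; rfl⟩
  exact hle hw

/-- `(T + 1) f₀` is the sum of the translates of `f₀ + f₁` by representatives of `K / I_K`,
since the number of these is `1` in `𝔽`. -/
lemma IsHeckeT.add_one_apply_zero [Algebra (ZMod S.p) 𝔽]
    (hff : IsFFamily C 𝔽 𝔽 (1 : Representation 𝔽 ↥C.K 𝔽) v0 ff)
    {T : Module.End 𝔽 ↥(IndSub C 𝔽 𝔽 (1 : Representation 𝔽 ↥C.K 𝔽))}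
    (hT : IsHeckeT C 𝔽 𝔽 (1 : Representation 𝔽 ↥C.K 𝔽) LinearMap.id T) :
    ∃ U : Finset S.GG, (T + 1) (ff 0) = (ff 0 + ff 1) +
      ∑ u ∈ U, indRep C 𝔽 𝔽 (1 : Representation 𝔽 ↥C.K 𝔽) (u * C.βK) (ff 0 + ff 1) := by
  obtain ⟨U0, hU0, hcard⟩ := exists_isReps (S.NkSubgroup C.nK) (S.NkSubgroup (C.nK + 1))
  obtain ⟨U1, hU1, -⟩ := exists_isReps (S.NkSubgroup (C.nK + 1)) (S.NkSubgroup (C.nK + 1 + 1))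
  have h2 : C.nK + 1 + 1 = C.nK + 2 := by ring
  have hU2 := hU0.mul (NkSubgroup_mono (by omega)) (NkSubgroup_mono (by omega)) hU1
  have hinj := hU0.mul_injOn hU1
  rw [h2] at hU1 hU2
  have hcard0 : ((U0.card : ℕ) : 𝔽) = 0 := by
    obtain ⟨m, hm⟩ := prime_dvd_card_quotient (S := S) C.nK
    have hp : ((S.p : ℕ) : 𝔽) = 0 := by
      rw [← map_natCast (algebraMap (ZMod S.p) 𝔽), ZMod.natCast_self, map_zero]
    rw [hcard, hm, Nat.cast_mul, hp, zero_mul]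
  have hstd : (ff 0 : S.GG → 𝔽) = stdFn C 𝔽 𝔽 (1 : Representation 𝔽 ↥C.K 𝔽) 1 v0 := by
    ext x
    rw [hff.zero_apply, stdFn_one_apply, mul_one]
  have hTf := hT.2 v0 (ff 0) hstd _ U1 hU2 hU1
  refine ⟨U0, Subtype.ext (funext fun x => ?_)⟩
  have hL : (((T + 1) (ff 0) : ↥(IndSub C 𝔽 𝔽 (1 : Representation 𝔽 ↥C.K 𝔽))) : S.GG → 𝔽) x =
      (T (ff 0) : S.GG → 𝔽) x + (ff 0 : S.GG → 𝔽) x := rfl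
  have hR : ((ff 0 + ff 1 + ∑ u ∈ U0,
      indRep C 𝔽 𝔽 (1 : Representation 𝔽 ↥C.K 𝔽) (u * C.βK) (ff 0 + ff 1) :
        ↥(IndSub C 𝔽 𝔽 (1 : Representation 𝔽 ↥C.K 𝔽))) : S.GG → 𝔽) x =
      (ff 0 : S.GG → 𝔽) x + (ff 1 : S.GG → 𝔽) x +
        ∑ u ∈ U0, ((ff 0 : S.GG → 𝔽) (x * (u * C.βK)) + (ff 1 : S.GG → 𝔽) (x * (u * C.βK))) := by
    rw [Submodule.coe_add, Submodule.coe_add, Submodule.coe_sum, Pi.add_apply, Pi.add_apply,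
      Finset.sum_apply]
    rfl
  have hf0 : ∀ u ∈ U0, (ff 0 : S.GG → 𝔽) (x * (u * C.βK)) = (ff 0 : S.GG → 𝔽) x := fun u hu => by
    have : u * C.βK ∈ C.K := C.K.mul_mem (Nk_subset_K (hU0.1 hu)) βK_mem
    rw [hff.zero_apply, hff.zero_apply, C.K.mul_mem_cancel_right this]
  rw [hL, hR, hTf, Finset.sum_image hinj, Finset.sum_product, Pi.add_apply, Finset.sum_apply,
    Finset.sum_apply, Finset.sum_add_distrib, Finset.sum_congr rfl hf0, Finset.sum_const,
    nsmul_eq_mul, hcard0, hff.one_apply hU1 x]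
  have hconv : ∀ u ∈ U0, (ff 1 : S.GG → 𝔽) (x * (u * C.βK)) =
      ∑ w ∈ U1, if x * (u * w * S.alphaE⁻¹) ∈ C.K then v0 else 0 := fun u _ => by
    rw [hff.one_apply hU1]
    refine Finset.sum_congr rfl fun w _ => ?_
    have : x * (u * C.βK) * (C.βK * w * S.alphaE⁻¹) = x * (u * w * S.alphaE⁻¹) := by
      calc _ = x * (u * (C.βK * C.βK) * w * S.alphaE⁻¹) := by simp only [mul_assoc]
        _ = _ := by rw [βK_sq, mul_one]
    rw [this]
  rw [Finset.sum_congr rfl hconv]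
  simp only [Finset.sum_apply, stdFn_one_apply, sigma'_one, LinearMap.id_apply]
  ring

lemma IsHeckeT.range_add_one_le [Algebra (ZMod S.p) 𝔽]
    (hff : IsFFamily C 𝔽 𝔽 (1 : Representation 𝔽 ↥C.K 𝔽) v0 ff)
    {T : Module.End 𝔽 ↥(IndSub C 𝔽 𝔽 (1 : Representation 𝔽 ↥C.K 𝔽))}
    (hT : IsHeckeT C 𝔽 𝔽 (1 : Representation 𝔽 ↥C.K 𝔽) LinearMap.id T) :
    LinearMap.range (T + 1) ≤
      orbitSpan 𝔽 (indRep C 𝔽 𝔽 (1 : Representation 𝔽 ↥C.K 𝔽)) (ff 0 + ff 1) := by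
  have hself : ff 0 + ff 1 ∈
      orbitSpan 𝔽 (indRep C 𝔽 𝔽 (1 : Representation 𝔽 ↥C.K 𝔽)) (ff 0 + ff 1) :=
    Submodule.subset_span ⟨1, by rw [map_one]; rfl⟩
  have h0 : (T + 1) (ff 0) ∈
      orbitSpan 𝔽 (indRep C 𝔽 𝔽 (1 : Representation 𝔽 ↥C.K 𝔽)) (ff 0 + ff 1) := by
    obtain ⟨U, hU⟩ := hT.add_one_apply_zero hff
    rw [hU]
    exact add_mem hself (sum_mem fun u _ => indRep_mem_orbitSpan _ hself)
  rw [LinearMap.range_eq_map, ← hff.orbitSpan_zero, orbitSpan, Submodule.map_span,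
    Submodule.span_le]
  rintro _ ⟨_, ⟨g, rfl⟩, rfl⟩
  have : (T + 1) (indRep C 𝔽 𝔽 (1 : Representation 𝔽 ↥C.K 𝔽) g (ff 0)) =
      indRep C 𝔽 𝔽 (1 : Representation 𝔽 ↥C.K 𝔽) g ((T + 1) (ff 0)) := by
    rw [LinearMap.add_apply, LinearMap.add_apply, hT.1, map_add]
    rfl
  rw [this]
  exact indRep_mem_orbitSpan g h0

end TrivialWeight

/-- If the image of `f₀ + f₁` generates `(ind_K^G 1)/(T+1)`, then
`f₀ + f₁` generates `ind_K^G 1`. -/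
theorem stmt7
    (S : Setting) (C : Chamber S)
    (𝔽 : Type) [Field 𝔽] [IsAlgClosed 𝔽] [Algebra (ZMod S.p) 𝔽]
    [Algebra.IsAlgebraic (ZMod S.p) 𝔽]
    (v0 : 𝔽) (ff : ℤ → ↥(IndSub C 𝔽 𝔽 (1 : Representation 𝔽 ↥C.K 𝔽)))
    (hff : IsFFamily C 𝔽 𝔽 (1 : Representation 𝔽 ↥C.K 𝔽) v0 ff)
    (Ttr : Module.End 𝔽 ↥(IndSub C 𝔽 𝔽 (1 : Representation 𝔽 ↥C.K 𝔽)))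
    (hTtr : IsHeckeT C 𝔽 𝔽 (1 : Representation 𝔽 ↥C.K 𝔽) LinearMap.id Ttr)
    (hgen : orbitSpan 𝔽 (indRep C 𝔽 𝔽 (1 : Representation 𝔽 ↥C.K 𝔽)) (ff 0 + ff 1) ⊔
      LinearMap.range (Ttr + 1) = ⊤) :
    orbitSpan 𝔽 (indRep C 𝔽 𝔽 (1 : Representation 𝔽 ↥C.K 𝔽)) (ff 0 + ff 1) = ⊤ := by
  rwa [sup_eq_left.2 (hTtr.range_add_one_le hff)] at hgen

end U21
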